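/- Let {f_i}_{i∈I_c} and {g_j}_{j∈I_d} be families of flow and jump maps, let h⁰, h ∈ H, and let SW be a family of impulsive and switching sequences. Let Assumption 4 hold. If for each i ∈ I_c the function φ̄_i is positive definite and there exists a constant θ_i > 0 such that SW ⊂ ∩_{i∈I_c} S_DT^i[θ_i] and sup_{a>0} ∫_a^{ᾱ(a)} ds/φ̄_i(s) < inf_{t≥0} ∫_t^{t+θ_i} p_i(s) ds =: M_i, with M_i > 0, then {Σ_σ}_{σ∈SW} is strongly (h⁰,h)-ISS. -/

import Mathlib

open MeasureTheory Filter Set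
open scoped Classical

noncomputable section

/-- State/input spaces: `ℝ^k` with the Euclidean norm. -/
abbrev Stt (k : ℕ) : Type := EuclideanSpace ℝ (Fin k)

/-- An impulse-time sequence, identified with its (locally finite) set of impulse
times, a subset of `(0,∞)` with finitely many points below any bound. -/
def IsImpulseSeq (γ : Set ℝ) : Prop :=
  γ ⊆ Set.Ioi (0 : ℝ) ∧ ∀ T : ℝ, (γ ∩ Set.Iic T).Finite

/-- `n^γ_{(s,t]}`: the number of impulse times in the interval `(s,t]`. -/
def nJumps (γ : Set ℝ) (s t : ℝ) : ℕ := (γ ∩ Set.Ioc s t).ncard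

/-- Uniform incremental boundedness of a set of impulse-time sequences. -/
def UIB (S : Set (Set ℝ)) : Prop :=
  ∃ φ : ℝ → ℝ, ContinuousOn φ (Set.Ici 0) ∧ MonotoneOn φ (Set.Ici 0) ∧
    (∀ s : ℝ, 0 ≤ s → 0 ≤ φ s) ∧
    ∀ γ ∈ S, ∀ t0 t : ℝ, 0 ≤ t0 → t0 < t → (nJumps γ t0 t : ℝ) ≤ φ (t - t0)

/-- Class `K∞` functions `[0,∞) → [0,∞)`. -/
def ClassKInf (α : ℝ → ℝ) : Prop :=
  ContinuousOn α (Set.Ici 0) ∧ StrictMonoOn α (Set.Ici 0) ∧ α 0 = 0 ∧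
    ∀ M : ℝ, ∃ r : ℝ, 0 ≤ r ∧ M ≤ α r

/-- Class `KL` functions. -/
def ClassKL (β : ℝ → ℝ → ℝ) : Prop :=
  (∀ t : ℝ, 0 ≤ t → ClassKInf fun r => β r t) ∧
  ∀ r : ℝ, 0 ≤ r → AntitoneOn (fun t => β r t) (Set.Ici 0) ∧
    Filter.Tendsto (fun t => β r t) Filter.atTop (nhds 0)

/-- Positive definite functions `[0,∞) → [0,∞)`. -/
def PosDef (ρ : ℝ → ℝ) : Prop :=
  ContinuousOn ρ (Set.Ici 0) ∧ ρ 0 = 0 ∧ ∀ r : ℝ, 0 < r → 0 < ρ r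

/-- Locally integrable (on compacts) function `[0,∞) → ℝ` (extended to `ℝ`). -/
def LocIntegrable (p : ℝ → ℝ) : Prop :=
  ∀ a b : ℝ, MeasureTheory.IntegrableOn p (Set.Icc a b)

/-- Inputs: measurable, locally essentially bounded functions. -/
def IsInput {m : ℕ} (u : ℝ → Stt m) : Prop :=
  Measurable u ∧ ∀ T : ℝ, ∃ C : ℝ, ∀ᵐ t ∂MeasureTheory.volume, t ∈ Set.Icc 0 T → ‖u t‖ ≤ C

/-- `‖u_I‖_γ`: max of the essential supremum of `‖u‖` over `I` and the supremum of
`‖u‖` over `γ ∩ I`. -/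
def inputNorm {m : ℕ} (γ : Set ℝ) (u : ℝ → Stt m) (I : Set ℝ) : ℝ :=
  max (essSup (fun t => ‖u t‖) (MeasureTheory.volume.restrict I))
      (sSup ((fun t => ‖u t‖) '' (γ ∩ I)))

/-- Solution of the impulsive system `(γ,f,g)` on `[t0,T)` with initial state `x0`
and input `u` (Carathéodory solutions, in integral form, between impulses). -/
structure IsSolution {n m : ℕ} (γ : Set ℝ) (f g : ℝ → Stt n → Stt m → Stt n)
    (t0 : ℝ) (x0 : Stt n) (u : ℝ → Stt m) (T : EReal) (x : ℝ → Stt n) : Prop where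
  lt : (t0 : EReal) < T
  init : x t0 = x0
  flow : ∀ t1 t2 : ℝ, t0 ≤ t1 → t1 ≤ t2 → (t2 : EReal) < T → Set.Ioc t1 t2 ∩ γ = ∅ →
    MeasureTheory.IntegrableOn (fun s => f s (x s) (u s)) (Set.Icc t1 t2) ∧
    x t2 = x t1 + ∫ s in t1..t2, f s (x s) (u s)
  jump : ∀ t ∈ γ, t0 < t → (t : EReal) < T →
    ∃ L : Stt n, Filter.Tendsto x (nhdsWithin t (Set.Iio t)) (nhds L) ∧
      x t = L + g t L (u t)

/-- Maximally defined solution. -/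
def IsMaxSolution {n m : ℕ} (γ : Set ℝ) (f g : ℝ → Stt n → Stt m → Stt n)
    (t0 : ℝ) (x0 : Stt n) (u : ℝ → Stt m) (T : EReal) (x : ℝ → Stt n) : Prop :=
  IsSolution γ f g t0 x0 u T x ∧
    ∀ (T' : EReal) (x' : ℝ → Stt n), IsSolution γ f g t0 x0 u T' x' →
      (∀ t : ℝ, t0 ≤ t → (t : EReal) < T → x' t = x t) → T' ≤ T

/-- Weak `(h⁰,h)`-ISS of a parametrized family of impulsive systems. -/
def WeaklyISS {n m : ℕ} {Λ : Type*} (γ : Λ → Set ℝ)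
    (f g : Λ → ℝ → Stt n → Stt m → Stt n) (h0 h : ℝ → Stt n → ℝ) : Prop :=
  ∃ β : ℝ → ℝ → ℝ, ∃ ρ : ℝ → ℝ, ClassKL β ∧ ClassKInf ρ ∧
    ∀ (l : Λ) (t0 : ℝ) (x0 : Stt n) (u : ℝ → Stt m) (T : EReal) (x : ℝ → Stt n),
      0 ≤ t0 → IsInput u → IsMaxSolution (γ l) (f l) (g l) t0 x0 u T x →
      ∀ t : ℝ, t0 ≤ t → (t : EReal) < T →
        h t (x t) ≤ β (h0 t0 x0) (t - t0) + ρ (inputNorm (γ l) u (Set.Ioc t0 t))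

/-- Strong `(h⁰,h)`-ISS of a parametrized family of impulsive systems. -/
def StronglyISS {n m : ℕ} {Λ : Type*} (γ : Λ → Set ℝ)
    (f g : Λ → ℝ → Stt n → Stt m → Stt n) (h0 h : ℝ → Stt n → ℝ) : Prop :=
  ∃ β : ℝ → ℝ → ℝ, ∃ ρ : ℝ → ℝ, ClassKL β ∧ ClassKInf ρ ∧
    ∀ (l : Λ) (t0 : ℝ) (x0 : Stt n) (u : ℝ → Stt m) (T : EReal) (x : ℝ → Stt n),
      0 ≤ t0 → IsInput u → IsMaxSolution (γ l) (f l) (g l) t0 x0 u T x →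
      ∀ t : ℝ, t0 ≤ t → (t : EReal) < T →
        h t (x t) ≤ β (h0 t0 x0) (t - t0 + (nJumps (γ l) t0 t : ℝ)) +
          ρ (inputNorm (γ l) u (Set.Ioc t0 t))

/-- Locally Lipschitz on a set. -/
def LocLipschitzOn {α β : Type*} [PseudoEMetricSpace α] [PseudoEMetricSpace β]
    (s : Set α) (f : α → β) : Prop :=
  ∀ x ∈ s, ∃ K : NNReal, ∃ t ∈ nhdsWithin x s, LipschitzOnWith K f t

/-- `V ∈ V(γ)` with `Vm` its left-limit function at impulse times: `V` is locally
Lipschitz on each inter-impulse strip and has the joint left limit `Vm τ ξ`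
at each `τ ∈ γ`. -/
def InClassV {n : ℕ} (γ : Set ℝ) (V Vm : ℝ → Stt n → ℝ) : Prop :=
  (∀ a b : ℝ, 0 ≤ a → Set.Ioo a b ∩ γ = ∅ →
    LocLipschitzOn (Set.Ico a b ×ˢ (Set.univ : Set (Stt n)))
      (fun q : ℝ × Stt n => V q.1 q.2)) ∧
  ∀ τ ∈ γ, ∀ ξ : Stt n,
    Filter.Tendsto (fun q : ℝ × Stt n => V q.1 q.2)
      (nhdsWithin (τ, ξ) (Set.Iio τ ×ˢ (Set.univ : Set (Stt n)))) (nhds (Vm τ ξ))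

/-- Upper-right Dini derivative of `V` along the flow map `f`. -/
def DiniAlong {n m : ℕ} (f : ℝ → Stt n → Stt m → Stt n) (V : ℝ → Stt n → ℝ)
    (t : ℝ) (ξ : Stt n) (μ : Stt m) : ℝ :=
  Filter.limsup (fun d : ℝ => (V (t + d) (ξ + d • f t ξ μ) - V t ξ) / d)
    (nhdsWithin 0 (Set.Ioi 0))

/-- Carathéodory function `[0,∞) × [0,∞) → ℝ`. -/
def Caratheodory2 (φ : ℝ → ℝ → ℝ) : Prop :=
  (∀ r : ℝ, Measurable fun t => φ t r) ∧
  (∀ t : ℝ, ContinuousOn (φ t) (Set.Ici 0)) ∧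
  ∀ a b c : ℝ, ∃ mK : ℝ → ℝ, MeasureTheory.IntegrableOn mK (Set.Icc a b) ∧
    ∀ t ∈ Set.Icc a b, ∀ r ∈ Set.Icc (0 : ℝ) c, |φ t r| ≤ mK t

/-- Assumption 1 of the paper, with all the data explicit. -/
def Assumption1 {n m : ℕ} {Λ : Type*} (γ : Λ → Set ℝ)
    (f g : Λ → ℝ → Stt n → Stt m → Stt n) (h0 h : ℝ → Stt n → ℝ)
    (V Vm : Λ → ℝ → Stt n → ℝ) (φ1 φ2 χ π : ℝ → ℝ)
    (vφ al : Λ → ℝ → ℝ → ℝ) : Prop :=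
  ClassKInf φ1 ∧ ClassKInf φ2 ∧ ClassKInf χ ∧ ClassKInf π ∧
  (∀ l : Λ, InClassV (γ l) (V l) (Vm l)) ∧
  (∀ l : Λ, Caratheodory2 (vφ l)) ∧
  (∀ (l : Λ) (t r : ℝ), 0 ≤ t → 0 ≤ r → 0 ≤ al l t r) ∧
  (∀ (l : Λ) (t : ℝ) (ξ : Stt n), 0 ≤ t →
    φ1 (h t ξ) ≤ V l t ξ ∧ V l t ξ ≤ φ2 (h0 t ξ)) ∧
  (∀ (l : Λ) (t : ℝ) (ξ : Stt n) (μ : Stt m), 0 ≤ t → t ∉ γ l → χ ‖μ‖ ≤ V l t ξ →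
    DiniAlong (f l) (V l) t ξ μ ≤ - vφ l t (V l t ξ)) ∧
  (∀ (l : Λ) (t : ℝ) (ξ : Stt n) (μ : Stt m), t ∈ γ l → χ ‖μ‖ ≤ Vm l t ξ →
    V l t (ξ + g l t ξ μ) ≤ al l t (Vm l t ξ)) ∧
  (∀ (l : Λ) (t : ℝ) (ξ : Stt n) (μ : Stt m), t ∈ γ l → Vm l t ξ ≤ χ ‖μ‖ →
    V l t (ξ + g l t ξ μ) ≤ π ‖μ‖)

/-- Solution of the scalar comparison differential/difference inclusion. -/
structure IsCompSol (γ : Set ℝ) (vφ al : ℝ → ℝ → ℝ) (t0 z0 : ℝ) (T : EReal)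
    (z : ℝ → ℝ) : Prop where
  lt : (t0 : EReal) < T
  init : z t0 = z0
  nonneg : ∀ t : ℝ, t0 ≤ t → (t : EReal) < T → 0 ≤ z t
  flow : ∀ t1 t2 : ℝ, t0 ≤ t1 → t1 ≤ t2 → (t2 : EReal) < T → Set.Ioc t1 t2 ∩ γ = ∅ →
    ∃ d : ℝ → ℝ, MeasureTheory.IntegrableOn d (Set.Icc t1 t2) ∧
      (∀ᵐ s ∂MeasureTheory.volume, s ∈ Set.Icc t1 t2 → d s ≤ - vφ s (z s)) ∧
      ∀ t ∈ Set.Icc t1 t2, z t = z t1 + ∫ s in t1..t, d s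
  jump : ∀ t ∈ γ, t0 < t → (t : EReal) < T →
    ∃ L : ℝ, Filter.Tendsto z (nhdsWithin t (Set.Iio t)) (nhds L) ∧ z t ≤ al t L

/-- The family of comparison systems is weakly GUAS. -/
def CompWeakGUAS {Λ : Type*} (γ : Λ → Set ℝ) (vφ al : Λ → ℝ → ℝ → ℝ) : Prop :=
  ∃ β : ℝ → ℝ → ℝ, ClassKL β ∧
    ∀ (l : Λ) (t0 z0 : ℝ) (T : EReal) (z : ℝ → ℝ), 0 ≤ t0 → 0 ≤ z0 →
      IsCompSol (γ l) (vφ l) (al l) t0 z0 T z →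
      ∀ t : ℝ, t0 ≤ t → (t : EReal) < T → z t ≤ β z0 (t - t0)

/-- The family of comparison systems is strongly GUAS. -/
def CompStrongGUAS {Λ : Type*} (γ : Λ → Set ℝ) (vφ al : Λ → ℝ → ℝ → ℝ) : Prop :=
  ∃ β : ℝ → ℝ → ℝ, ClassKL β ∧
    ∀ (l : Λ) (t0 z0 : ℝ) (T : EReal) (z : ℝ → ℝ), 0 ≤ t0 → 0 ≤ z0 →
      IsCompSol (γ l) (vφ l) (al l) t0 z0 T z →
      ∀ t : ℝ, t0 ≤ t → (t : EReal) < T → z t ≤ β z0 (t - t0 + (nJumps (γ l) t0 t : ℝ))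

/-- Nonnegative Carathéodory solution of the scalar ODE `ẇ = rhs(t,w)` on `[t0,T)`. -/
structure IsODESol (rhs : ℝ → ℝ → ℝ) (t0 : ℝ) (T : EReal) (w : ℝ → ℝ) : Prop where
  lt : (t0 : EReal) < T
  nonneg : ∀ t : ℝ, t0 ≤ t → (t : EReal) < T → 0 ≤ w t
  flow : ∀ t1 t2 : ℝ, t0 ≤ t1 → t1 ≤ t2 → (t2 : EReal) < T →
    IntervalIntegrable (fun s => rhs s (w s)) MeasureTheory.volume t1 t2 ∧
    w t2 = w t1 + ∫ s in t1..t2, rhs s (w s)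

/-- Maximally defined forward-in-time solution of `ẇ = rhs(t,w)`. -/
def IsMaxODESol (rhs : ℝ → ℝ → ℝ) (t0 : ℝ) (T : EReal) (w : ℝ → ℝ) : Prop :=
  IsODESol rhs t0 T w ∧
    ∀ (T' : EReal) (w' : ℝ → ℝ), IsODESol rhs t0 T' w' →
      (∀ t : ℝ, t0 ≤ t → (t : EReal) < T → w' t = w t) → T' ≤ T

/-- GUAS of the family of scalar ODEs `ẇ = −φ_λ(t,w)`. -/
def ODEFamilyGUAS {Λ : Type*} (vφ : Λ → ℝ → ℝ → ℝ) : Prop :=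
  ∃ β : ℝ → ℝ → ℝ, ClassKL β ∧
    ∀ (l : Λ) (t0 : ℝ) (T : EReal) (w : ℝ → ℝ), 0 ≤ t0 →
      IsMaxODESol (fun s r => -(vφ l s r)) t0 T w →
      T = (⊤ : EReal) ∧ ∀ t : ℝ, t0 ≤ t → w t ≤ β (w t0) (t - t0)

/-- Solution (on all of `[0,∞)`) of the scalar linear ODE `ẇ = −p(t)·w`. -/
def IsLinSol (p : ℝ → ℝ) (w : ℝ → ℝ) : Prop :=
  ∀ t1 t2 : ℝ, 0 ≤ t1 → t1 ≤ t2 →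
    IntervalIntegrable (fun s => p s * w s) MeasureTheory.volume t1 t2 ∧
    w t2 = w t1 + ∫ s in t1..t2, -(p s * w s)

/-- An impulsive and switching sequence, described through its impulse-time set,
its two switching signals (constant between impulses), and the left limit of the
first switching signal at impulse times. -/
structure SwSignal (Ic Id : Type*) where
  γ : Set ℝ
  σ1 : ℝ → Ic
  σ1m : ℝ → Ic
  σ2 : ℝ → Id
  impulse : IsImpulseSeq γ
  const1 : ∀ a b : ℝ, 0 ≤ a → Set.Ioo a b ∩ γ = ∅ → ∀ t ∈ Set.Ico a b, σ1 t = σ1 a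
  const2 : ∀ a b : ℝ, 0 ≤ a → Set.Ioo a b ∩ γ = ∅ → ∀ t ∈ Set.Ico a b, σ2 t = σ2 a
  leftlim : ∀ t ∈ γ, ∀ᶠ s in nhdsWithin t (Set.Iio t), σ1 s = σ1m t

/-- `σ ∈ SW(J)`. -/
def InSW {Ic Id : Type*} (σ : SwSignal Ic Id) (J : Set (Ic × Ic × Id)) : Prop :=
  ∀ t ∈ σ.γ, (σ.σ1m t, σ.σ1 t, σ.σ2 t) ∈ J

/-- Flow map of the switched impulsive system `Σ_σ`. -/
def swF {n m : ℕ} {Ic Id : Type*} (F : Ic → ℝ → Stt n → Stt m → Stt n)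
    (σ : SwSignal Ic Id) : ℝ → Stt n → Stt m → Stt n :=
  fun t ξ μ => F (σ.σ1 t) t ξ μ

/-- Jump map of the switched impulsive system `Σ_σ`. -/
def swG {n m : ℕ} {Ic Id : Type*} (G : Id → ℝ → Stt n → Stt m → Stt n)
    (σ : SwSignal Ic Id) : ℝ → Stt n → Stt m → Stt n :=
  fun t ξ μ => G (σ.σ2 t) t ξ μ

/-- Weak `(h⁰,h)`-ISS of the family `{Σ_σ}_{σ ∈ SW}`. -/
def SwWeaklyISS {n m : ℕ} {Ic Id : Type*} (F : Ic → ℝ → Stt n → Stt m → Stt n)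
    (G : Id → ℝ → Stt n → Stt m → Stt n) (SW : Set (SwSignal Ic Id))
    (h0 h : ℝ → Stt n → ℝ) : Prop :=
  ∃ β : ℝ → ℝ → ℝ, ∃ ρ : ℝ → ℝ, ClassKL β ∧ ClassKInf ρ ∧
    ∀ σ ∈ SW, ∀ (t0 : ℝ) (x0 : Stt n) (u : ℝ → Stt m) (T : EReal) (x : ℝ → Stt n),
      0 ≤ t0 → IsInput u → IsMaxSolution σ.γ (swF F σ) (swG G σ) t0 x0 u T x →
      ∀ t : ℝ, t0 ≤ t → (t : EReal) < T →
        h t (x t) ≤ β (h0 t0 x0) (t - t0) + ρ (inputNorm σ.γ u (Set.Ioc t0 t))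

/-- Strong `(h⁰,h)`-ISS of the family `{Σ_σ}_{σ ∈ SW}`. -/
def SwStronglyISS {n m : ℕ} {Ic Id : Type*} (F : Ic → ℝ → Stt n → Stt m → Stt n)
    (G : Id → ℝ → Stt n → Stt m → Stt n) (SW : Set (SwSignal Ic Id))
    (h0 h : ℝ → Stt n → ℝ) : Prop :=
  ∃ β : ℝ → ℝ → ℝ, ∃ ρ : ℝ → ℝ, ClassKL β ∧ ClassKInf ρ ∧
    ∀ σ ∈ SW, ∀ (t0 : ℝ) (x0 : Stt n) (u : ℝ → Stt m) (T : EReal) (x : ℝ → Stt n),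
      0 ≤ t0 → IsInput u → IsMaxSolution σ.γ (swF F σ) (swG G σ) t0 x0 u T x →
      ∀ t : ℝ, t0 ≤ t → (t : EReal) < T →
        h t (x t) ≤ β (h0 t0 x0) (t - t0 + (nJumps σ.γ t0 t : ℝ)) +
          ρ (inputNorm σ.γ u (Set.Ioc t0 t))

/-- Total activation time in `(t0,t]` of the flow modes in `A`. -/
def actT {Ic Id : Type*} (σ : SwSignal Ic Id) (A : Set Ic) (t0 t : ℝ) : ℝ :=
  (MeasureTheory.volume {r : ℝ | r ∈ Set.Ioc t0 t ∧ σ.σ1 r ∈ A}).toReal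

/-- Number of impulse times in `(t0,t]` whose mode combination lies in `Jp`. -/
def nJumpsIn {Ic Id : Type*} (σ : SwSignal Ic Id) (Jp : Set (Ic × Ic × Id))
    (t0 t : ℝ) : ℕ :=
  (σ.γ ∩ Set.Ioc t0 t ∩ {r : ℝ | (σ.σ1m r, σ.σ1 r, σ.σ2 r) ∈ Jp}).ncard

/-- Assumption 2 of the paper (for switched impulsive systems), data explicit. -/
def Assumption2 {n m : ℕ} {Ic Id : Type*}
    (F : Ic → ℝ → Stt n → Stt m → Stt n) (G : Id → ℝ → Stt n → Stt m → Stt n)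
    (h0 h : ℝ → Stt n → ℝ) (J : Set (Ic × Ic × Id))
    (v : Ic → ℝ → Stt n → ℝ) (φ1 φ2 χ π : ℝ → ℝ)
    (vφ : Ic → ℝ → ℝ → ℝ) (al : Ic × Ic × Id → ℝ → ℝ → ℝ) : Prop :=
  ClassKInf φ1 ∧ ClassKInf φ2 ∧ ClassKInf χ ∧ ClassKInf π ∧
  (∀ i : Ic, LocLipschitzOn ((Set.Ici (0 : ℝ)) ×ˢ (Set.univ : Set (Stt n)))
      (fun q : ℝ × Stt n => v i q.1 q.2)) ∧
  (∀ i : Ic, Caratheodory2 (vφ i)) ∧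
  (∀ e ∈ J, ∀ t r : ℝ, 0 ≤ t → 0 ≤ r → 0 ≤ al e t r) ∧
  (∀ (i : Ic) (t : ℝ) (ξ : Stt n), 0 ≤ t →
    φ1 (h t ξ) ≤ v i t ξ ∧ v i t ξ ≤ φ2 (h0 t ξ)) ∧
  (∀ (i : Ic) (t : ℝ) (ξ : Stt n) (μ : Stt m), 0 ≤ t → χ ‖μ‖ ≤ v i t ξ →
    DiniAlong (F i) (v i) t ξ μ ≤ - vφ i t (v i t ξ)) ∧
  (∀ (ι i : Ic) (j : Id), (ι, i, j) ∈ J → ∀ (t : ℝ) (ξ : Stt n) (μ : Stt m),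
    0 ≤ t → χ ‖μ‖ ≤ v ι t ξ → v i t (ξ + G j t ξ μ) ≤ al (ι, i, j) t (v ι t ξ)) ∧
  (∀ (ι i : Ic) (j : Id), (ι, i, j) ∈ J → ∀ (t : ℝ) (ξ : Stt n) (μ : Stt m),
    0 ≤ t → v ι t ξ ≤ χ ‖μ‖ → v i t (ξ + G j t ξ μ) ≤ π ‖μ‖)

section Auxiliary

open scoped Topology

/-- A function whose increments are dominated by those of an absolutely continuous function is
absolutely continuous. -/
lemma AbsolutelyContinuousOnInterval.of_dist_le {g W : ℝ → ℝ} {a b K : ℝ}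
    (hW : AbsolutelyContinuousOnInterval W a b)
    (h : ∀ s ∈ uIcc a b, ∀ t ∈ uIcc a b, dist (g s) (g t) ≤ K * dist (W s) (W t)) :
    AbsolutelyContinuousOnInterval g a b := by
  have h1 : Tendsto (fun E : ℕ × (ℕ → ℝ × ℝ) =>
      K * ∑ i ∈ Finset.range E.1, dist (W (E.2 i).1) (W (E.2 i).2))
      (AbsolutelyContinuousOnInterval.totalLengthFilter ⊓
        𝓟 (AbsolutelyContinuousOnInterval.disjWithin a b)) (𝓝 0) := by
    simpa using Tendsto.const_mul K hW
  refine squeeze_zero' (Eventually.of_forall fun E => Finset.sum_nonneg fun _ _ => dist_nonneg)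
    ?_ h1
  filter_upwards [mem_inf_of_right (mem_principal_self _)] with E hE
  rw [Finset.mul_sum]
  refine Finset.sum_le_sum fun i hi => ?_
  have := hE.1 i hi
  exact h _ this.1 _ this.2

lemma AbsolutelyContinuousOnInterval.le_of_deriv_nonpos {g : ℝ → ℝ} {a b : ℝ} (hab : a ≤ b)
    (hg : AbsolutelyContinuousOnInterval g a b)
    (h : ∀ᵐ s, s ∈ Ioo a b → deriv g s ≤ 0) : g b ≤ g a := by
  have h1 := hg.integral_deriv_eq_sub
  have h2 : ∫ x in a..b, deriv g x ≤ 0 := by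
    rw [intervalIntegral.integral_of_le hab, integral_Ioc_eq_integral_Ioo]
    apply integral_nonpos_of_ae
    rw [EventuallyLE, ae_restrict_iff' measurableSet_Ioo]
    exact h
  linarith

/-- The state part of a flow piece is continuous. -/
lemma continuousOn_of_eq_integral {k : ℕ} {x d : ℝ → Stt k} {a b : ℝ}
    (hd : IntegrableOn d (Icc a b))
    (hx : ∀ s ∈ Icc a b, x s = x a + ∫ r in a..s, d r) : ContinuousOn x (Icc a b) := by
  have := intervalIntegral.continuousOn_primitive_Icc (μ := volume) (f := d) (a := a) (b := b)
    (by simpa using hd)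
  refine ((continuousOn_const (c := x a)).add this).congr fun s hs => ?_
  rw [hx s hs, intervalIntegral.integral_of_le hs.1, ← integral_Icc_eq_integral_Ioc]
  rfl

lemma absolutelyContinuous_along {k : ℕ} {x d : ℝ → Stt k} {a b : ℝ} {V : ℝ → Stt k → ℝ}
    (ha : 0 ≤ a) (hab : a ≤ b)
    (hV : LocLipschitzOn (Ici (0 : ℝ) ×ˢ (univ : Set (Stt k)))
      (fun q : ℝ × Stt k => V q.1 q.2))
    (hd : IntegrableOn d (Icc a b))
    (hx : ∀ s ∈ Icc a b, x s = x a + ∫ r in a..s, d r) :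
    AbsolutelyContinuousOnInterval (fun s => V s (x s)) a b := by
  have hdi : IntervalIntegrable d volume a b :=
    (intervalIntegrable_iff_integrableOn_Icc_of_le hab).2 hd
  have hxc := continuousOn_of_eq_integral hd hx
  have hcomp : IsCompact ((fun s => (s, x s)) '' Icc a b) :=
    isCompact_Icc.image_of_continuousOn (continuousOn_id.prodMk hxc)
  have hll : LocallyLipschitzOn (Ici (0 : ℝ) ×ˢ (univ : Set (Stt k)))
      (fun q : ℝ × Stt k => V q.1 q.2) := fun y hy => hV y hy
  obtain ⟨K, hK⟩ := (hll.mono (s := (fun s => (s, x s)) '' Icc a b) (by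
    rintro _ ⟨s, hs, rfl⟩
    exact ⟨ha.trans hs.1, mem_univ _⟩)).exists_lipschitzOnWith_of_compact hcomp
  have hW : AbsolutelyContinuousOnInterval
      (fun s => s + ∫ r in a..s, ‖d r‖) a b := by
    refine AbsolutelyContinuousOnInterval.add ?_
      (hdi.norm.absolutelyContinuousOnInterval_intervalIntegral (by simp))
    exact (LipschitzWith.id.lipschitzOnWith (s := uIcc a b)).absolutelyContinuousOnInterval
  refine hW.of_dist_le (K := K) ?_
  rw [uIcc_of_le hab]
  have key : ∀ s ∈ Icc a b, ∀ t ∈ Icc a b, s ≤ t → dist (V s (x s)) (V t (x t)) ≤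
      K * dist (s + ∫ r in a..s, ‖d r‖) (t + ∫ r in a..t, ‖d r‖) := by
    intro s hs t ht hst
    refine (hK.dist_le_mul _ (mem_image_of_mem _ hs) _ (mem_image_of_mem _ ht)).trans ?_
    have hsub : ∀ r1 ∈ Icc a b, ∀ r2 ∈ Icc a b, IntervalIntegrable d volume r1 r2 :=
      fun r1 h1 r2 h2 => hdi.mono_set (by
        rw [uIcc_of_le hab]; exact (convex_Icc a b).ordConnected.uIcc_subset h1 h2)
    have haI : a ∈ Icc a b := ⟨le_rfl, hab⟩
    have h1 : x t - x s = ∫ r in s..t, d r := by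
      rw [hx t ht, hx s hs, ← intervalIntegral.integral_interval_sub_left
        (hsub _ haI _ ht) (hsub _ haI _ hs)]
      abel
    have h2 : (∫ r in a..t, ‖d r‖) - (∫ r in a..s, ‖d r‖) = ∫ r in s..t, ‖d r‖ :=
      intervalIntegral.integral_interval_sub_left (hsub _ haI _ ht).norm (hsub _ haI _ hs).norm
    have h3 : ‖x t - x s‖ ≤ ∫ r in s..t, ‖d r‖ := by
      rw [h1]; exact intervalIntegral.norm_integral_le_integral_norm hst
    have h4 : 0 ≤ ∫ r in s..t, ‖d r‖ :=
      intervalIntegral.integral_nonneg hst fun _ _ => norm_nonneg _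
    gcongr
    rw [Prod.dist_eq, dist_comm, dist_comm (x s), dist_eq_norm (x t), Real.dist_eq, Real.dist_eq,
      abs_of_nonneg (sub_nonneg.2 hst), abs_of_nonpos (by linarith)]
    exact max_le (by linarith) (by linarith)
  intro s hs t ht
  rcases le_total s t with hst | hst
  · exact key s hs t ht hst
  · rw [dist_comm, dist_comm (s + _)]
    exact key t ht s hs hst

/-- Along a flow piece the Dini derivative is almost everywhere the derivative of the composed
function. -/
lemma deriv_along_eq_dini {k l : ℕ} {x : ℝ → Stt k} {u : ℝ → Stt l}
    {f : ℝ → Stt k → Stt l → Stt k} {a b : ℝ} {V : ℝ → Stt k → ℝ}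
    (ha : 0 ≤ a) (hab : a ≤ b)
    (hV : LocLipschitzOn (Ici (0 : ℝ) ×ˢ (univ : Set (Stt k)))
      (fun q : ℝ × Stt k => V q.1 q.2))
    (hd : IntegrableOn (fun s => f s (x s) (u s)) (Icc a b))
    (hx : ∀ s ∈ Icc a b, x s = x a + ∫ r in a..s, f r (x r) (u r)) :
    ∀ᵐ s, s ∈ Ioo a b → deriv (fun s => V s (x s)) s = DiniAlong f V s (x s) (u s) := by
  have hdi : IntervalIntegrable (fun s => f s (x s) (u s)) volume a b :=
    (intervalIntegrable_iff_integrableOn_Icc_of_le hab).2 hd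
  filter_upwards [(absolutelyContinuous_along ha hab hV hd hx).ae_differentiableAt,
    hdi.ae_hasDerivAt_integral] with s h1 h2 hs
  have hsu : s ∈ uIcc a b := by rw [uIcc_of_le hab]; exact ⟨hs.1.le, hs.2.le⟩
  have hz := (h1 hsu).hasDerivAt
  have hxd : HasDerivAt x (f s (x s) (u s)) s := by
    have h3 := (h2 hsu a (by simp)).const_add (x a)
    refine h3.congr_of_eventuallyEq ?_
    filter_upwards [Icc_mem_nhds hs.1 hs.2] with r hr using hx r hr
  obtain ⟨K, W, hW, hK⟩ := hV (s, x s) ⟨(ha.trans hs.1.le : (0 : ℝ) ≤ s), mem_univ _⟩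
  set e := f s (x s) (u s) with he
  have hadd : Tendsto (fun d : ℝ => s + d) (𝓝[>] 0) (𝓝 s) := by
    have : Tendsto (fun d : ℝ => s + d) (𝓝 0) (𝓝 (s + 0)) :=
      (continuous_const.add continuous_id).tendsto 0
    rw [add_zero] at this
    exact this.mono_left nhdsWithin_le_nhds
  have hpos : ∀ᶠ d : ℝ in 𝓝[>] 0, 0 < d := self_mem_nhdsWithin
  have hm1 : ∀ᶠ d : ℝ in 𝓝[>] 0, (s + d, x s + d • e) ∈ W := by
    have : Tendsto (fun d : ℝ => (s + d, x s + d • e)) (𝓝[>] 0)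
        (𝓝[Ici (0 : ℝ) ×ˢ (univ : Set (Stt k))] (s, x s)) := by
      refine tendsto_nhdsWithin_iff.2 ⟨hadd.prodMk_nhds ?_, ?_⟩
      · have : Tendsto (fun d : ℝ => x s + d • e) (𝓝 0) (𝓝 (x s + (0 : ℝ) • e)) :=
          (continuous_const.add (continuous_id.smul continuous_const)).tendsto 0
        rw [zero_smul, add_zero] at this
        exact this.mono_left nhdsWithin_le_nhds
      · filter_upwards [hpos] with d hd0
        exact ⟨by simp only [mem_Ici]; linarith [hs.1], mem_univ _⟩
    exact this hW
  have hm2 : ∀ᶠ d : ℝ in 𝓝[>] 0, (s + d, x (s + d)) ∈ W := by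
    have : Tendsto (fun d : ℝ => (s + d, x (s + d))) (𝓝[>] 0)
        (𝓝[Ici (0 : ℝ) ×ˢ (univ : Set (Stt k))] (s, x s)) := by
      refine tendsto_nhdsWithin_iff.2 ⟨hadd.prodMk_nhds ?_, ?_⟩
      · exact hxd.continuousAt.tendsto.comp hadd
      · filter_upwards [hpos] with d hd0
        exact ⟨by simp only [mem_Ici]; linarith [hs.1], mem_univ _⟩
    exact this hW
  have hslope : ∀ {E : Type} [NormedAddCommGroup E] [NormedSpace ℝ E] (g : ℝ → E) (g' : E),
      HasDerivAt g g' s → Tendsto (fun d : ℝ => d⁻¹ • (g (s + d) - g s)) (𝓝[>] 0) (𝓝 g') := by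
    intro E _ _ g g' hg
    exact (hasDerivAt_iff_tendsto_slope_zero.1 hg).mono_left
      (nhdsWithin_mono _ fun y (hy : 0 < y) => hy.ne')
  have hq1 := hslope _ _ hz
  have hq2 := hslope _ _ hxd
  have herr : Tendsto (fun d : ℝ => (K : ℝ) * ‖d⁻¹ • (x (s + d) - x s) - e‖) (𝓝[>] 0) (𝓝 0) := by
    have := ((hq2.sub_const e).norm).const_mul (K : ℝ)
    simpa using this
  have hdiff : Tendsto (fun d : ℝ => (V (s + d) (x s + d • e) - V s (x s)) / d -
      d⁻¹ • (V (s + d) (x (s + d)) - V s (x s))) (𝓝[>] 0) (𝓝 0) := by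
    refine squeeze_zero_norm' ?_ herr
    filter_upwards [hpos, hm1, hm2] with d hd0 hd1 hd2
    have h5 := hK.dist_le_mul _ hd1 _ hd2
    have h6 : dist (s + d, x s + d • e) (s + d, x (s + d)) =
        ‖(x (s + d) - x s) - d • e‖ := by
      rw [Prod.dist_eq, dist_self, dist_comm, dist_eq_norm, max_eq_right (norm_nonneg _)]
      rw [sub_sub]
    have h7 : d⁻¹ • (x (s + d) - x s) - e = d⁻¹ • ((x (s + d) - x s) - d • e) := by
      rw [smul_sub d⁻¹ (x (s + d) - x s), smul_smul, inv_mul_cancel₀ hd0.ne', one_smul]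
    rw [h7, norm_smul, Real.norm_of_nonneg (inv_nonneg.2 hd0.le)]
    rw [h6, Real.dist_eq] at h5
    have h8 : (V (s + d) (x s + d • e) - V s (x s)) / d -
      d⁻¹ • (V (s + d) (x (s + d)) - V s (x s)) =
        d⁻¹ * (V (s + d) (x s + d • e) - V (s + d) (x (s + d))) := by
      rw [smul_eq_mul]; ring
    rw [h8, norm_mul, Real.norm_of_nonneg (inv_nonneg.2 hd0.le), Real.norm_eq_abs]
    calc d⁻¹ * _ ≤ d⁻¹ * (K * ‖(x (s + d) - x s) - d • e‖) := by gcongr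
      _ = _ := by ring
  have hlim := hdiff.add hq1
  simp only [sub_add_cancel, zero_add] at hlim
  exact hlim.limsup_eq.symm

lemma intervalIntegrable_of_continuousOn_Ioi {w : ℝ → ℝ} (hw : ContinuousOn w (Ioi 0)) {a b : ℝ}
    (ha : 0 < a) (hb : 0 < b) : IntervalIntegrable w volume a b :=
  (hw.mono fun _ hy => (lt_min ha hb).trans_le hy.1).intervalIntegrable

/-- Separation of variables for the differential inequality `z' ≤ -p φ(z)`. -/
lemma integral_le_of_deriv_le {z p φ : ℝ → ℝ} {a b : ℝ} (hab : a ≤ b)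
    (hz : AbsolutelyContinuousOnInterval z a b) (hpi : IntervalIntegrable p volume a b)
    (hp : ∀ s ∈ Icc a b, 0 ≤ p s) (hφ : ContinuousOn φ (Ioi 0)) (hφp : ∀ y, 0 < y → 0 < φ y)
    (hpos : ∀ s ∈ Ioc a b, 0 < z s) (hpos' : 0 < z b)
    (hder : ∀ᵐ s, s ∈ Ioo a b → deriv z s ≤ -(p s * φ (z s))) :
    z b ≤ z a ∧ ∫ s in a..b, p s ≤ ∫ y in (z b)..(z a), (φ y)⁻¹ := by
  have hanti : ∀ s ∈ Icc a b, ∀ t ∈ Icc a b, s ≤ t → z t ≤ z s := by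
    intro s hs t ht hst
    refine (hz.mono (c := s) (d := t) ?_).le_of_deriv_nonpos hst ?_
    · rw [uIcc_of_le hab, uIcc_of_le hst]; exact Icc_subset_Icc hs.1 ht.2
    · filter_upwards [hder] with r hr hr'
      have hrI : r ∈ Ioo a b := ⟨hs.1.trans_lt hr'.1, hr'.2.trans_le ht.2⟩
      have := mul_nonneg (hp r ⟨hrI.1.le, hrI.2.le⟩) (hφp _ (hpos r ⟨hrI.1, hrI.2.le⟩)).le
      linarith [hr hrI]
  have haI : a ∈ Icc a b := ⟨le_rfl, hab⟩
  have hbI : b ∈ Icc a b := ⟨hab, le_rfl⟩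
  refine ⟨hanti a haI b hbI hab, ?_⟩
  have hw : ContinuousOn (fun y => (φ y)⁻¹) (Ioi 0) := hφ.inv₀ fun y hy => (hφp y hy).ne'
  obtain ⟨K, hK⟩ := (isCompact_Icc (a := z b) (b := z a)).exists_bound_of_continuousOn
    (hw.mono fun y hy => hpos'.trans_le hy.1)
  have hmem : ∀ s ∈ Icc a b, z s ∈ Icc (z b) (z a) := fun s hs =>
    ⟨hanti s hs b hbI hs.2, hanti a haI s hs hs.1⟩
  have hpz : ∀ s ∈ Icc a b, 0 < z s := fun s hs => hpos'.trans_le (hmem s hs).1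
  set E : ℝ → ℝ := fun s => ∫ y in (z b)..(z s), (φ y)⁻¹ with hE
  have hEac : AbsolutelyContinuousOnInterval E a b := by
    refine hz.of_dist_le (K := K) ?_
    rw [uIcc_of_le hab]
    intro s hs t ht
    rw [dist_comm, dist_comm (z s), Real.dist_eq, Real.dist_eq,
      intervalIntegral.integral_interval_sub_left
      (intervalIntegrable_of_continuousOn_Ioi hw hpos' (hpz t ht))
      (intervalIntegrable_of_continuousOn_Ioi hw hpos' (hpz s hs)), ← Real.norm_eq_abs]
    refine intervalIntegral.norm_integral_le_of_norm_le_const fun y hy => hK y ?_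
    exact (convex_Icc _ _).ordConnected.uIcc_subset (hmem s hs) (hmem t ht) (uIoc_subset_uIcc hy)
  have hPac : AbsolutelyContinuousOnInterval (fun s => E s + ∫ r in a..s, p r) a b :=
    hEac.add (hpi.absolutelyContinuousOnInterval_intervalIntegral (by simp))
  have := hPac.le_of_deriv_nonpos hab (by
    filter_upwards [hder, hz.ae_differentiableAt, hpi.ae_hasDerivAt_integral] with s h1 h2 h3 hs
    have hsI : s ∈ Icc a b := ⟨hs.1.le, hs.2.le⟩
    have hsu : s ∈ uIcc a b := by rwa [uIcc_of_le hab]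
    have hH : HasDerivAt (fun r => ∫ y in (z b)..r, (φ y)⁻¹) (φ (z s))⁻¹ (z s) := by
      have hnh : Ioi (0 : ℝ) ∈ 𝓝 (z s) := Ioi_mem_nhds (hpz s hsI)
      refine intervalIntegral.integral_hasDerivAt_right
        (intervalIntegrable_of_continuousOn_Ioi hw hpos' (hpz s hsI)) ?_ (hw.continuousAt hnh)
      exact hw.stronglyMeasurableAtFilter isOpen_Ioi _ (hpz s hsI)
    have hEd : HasDerivAt E ((φ (z s))⁻¹ * deriv z s) s :=
      hH.comp s (h2 hsu).hasDerivAt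
    rw [(hEd.fun_add (h3 hsu a (by simp))).deriv]
    have hφs := hφp _ (hpz s hsI)
    have : (φ (z s))⁻¹ * deriv z s ≤ (φ (z s))⁻¹ * -(p s * φ (z s)) :=
      mul_le_mul_of_nonneg_left (h1 hs) (inv_nonneg.2 hφs.le)
    have h5 : (φ (z s))⁻¹ * -(p s * φ (z s)) = - p s := by field_simp
    linarith)
  simpa [hE] using this

/-- Class `KL` majorants of relations `Q r t y` enjoying uniform boundedness, stability and
attractivity. -/
lemma exists_classKL_bound {Q : ℝ → ℝ → ℝ → Prop}
    (hbdd : ∀ R, ∃ C, ∀ r t y, 0 ≤ r → r ≤ R → 0 ≤ t → Q r t y → y ≤ C)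
    (hstab : ∀ ε > 0, ∃ δ > 0, ∀ r t y, 0 ≤ r → r ≤ δ → 0 ≤ t → Q r t y → y ≤ ε)
    (hattr : ∀ R, ∀ ε > 0, ∃ T, ∀ r t y, 0 ≤ r → r ≤ R → 0 ≤ t → T ≤ t → Q r t y → y ≤ ε) :
    ∃ β, ClassKL β ∧ ∀ r t y, 0 ≤ r → 0 ≤ t → Q r t y → y ≤ β r t := by
  set S : ℝ → ℝ → Set ℝ := fun R T =>
    insert 0 {y | ∃ r t, 0 ≤ r ∧ r ≤ R ∧ 0 ≤ t ∧ T ≤ t ∧ Q r t y} with hS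
  set b : ℝ → ℝ → ℝ := fun R T => sSup (S R T) with hb
  have hne : ∀ R T, (S R T).Nonempty := fun R T => ⟨0, mem_insert _ _⟩
  have hSb : ∀ R T, BddAbove (S R T) := by
    intro R T
    obtain ⟨C, hC⟩ := hbdd R
    refine ⟨max 0 C, ?_⟩
    rintro y (rfl | ⟨r, t, h0, h1, h2, -, h3⟩)
    · exact le_max_left _ _
    · exact (hC r t y h0 h1 h2 h3).trans (le_max_right _ _)
  have hb0 : ∀ R T, 0 ≤ b R T := fun R T => le_csSup (hSb R T) (mem_insert _ _)
  have hmono : ∀ T, Monotone fun R => b R T := by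
    intro T R R' hR
    refine csSup_le_csSup (hSb R' T) (hne R T) (insert_subset_insert ?_)
    rintro y ⟨r, t, h0, h1, h2⟩
    exact ⟨r, t, h0, h1.trans hR, h2⟩
  have hant : ∀ R T T', T ≤ T' → b R T' ≤ b R T := by
    intro R T T' hT
    refine csSup_le_csSup (hSb R T) (hne R T') (insert_subset_insert ?_)
    rintro y ⟨r, t, h0, h1, h2, h3, h4⟩
    exact ⟨r, t, h0, h1, h2, hT.trans h3, h4⟩
  have hbs : ∀ ε > 0, ∃ δ > 0, ∀ R ≤ δ, ∀ T, b R T ≤ ε := by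
    intro ε hε
    obtain ⟨δ, hδ, h⟩ := hstab ε hε
    refine ⟨δ, hδ, fun R hR T => csSup_le (hne R T) ?_⟩
    rintro y (rfl | ⟨r, t, h0, h1, h2, -, h3⟩)
    · exact hε.le
    · exact h r t y h0 (h1.trans hR) h2 h3
  have hba : ∀ R, ∀ ε > 0, ∃ T0, ∀ T ≥ T0, b R T ≤ ε := by
    intro R ε hε
    obtain ⟨T0, h⟩ := hattr R ε hε
    refine ⟨T0, fun T hT => csSup_le (hne R T) ?_⟩
    rintro y (rfl | ⟨r, t, h0, h1, h2, h3, h4⟩)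
    · exact hε.le
    · exact h r t y h0 h1 h2 (hT.trans h3) h4
  have hint : ∀ T c d, IntervalIntegrable (fun R => b R T) volume c d :=
    fun T c d => (hmono T).intervalIntegrable
  have hmonos : ∀ T R, 0 ≤ R → Monotone fun s => b (R * s) T := fun T R hR s s' hs =>
    hmono T (mul_le_mul_of_nonneg_left hs hR)
  have hints : ∀ T R, 0 ≤ R → IntervalIntegrable (fun s => b (R * s) T) volume 1 2 :=
    fun T R hR => (hmonos T R hR).intervalIntegrable
  set A : ℝ → ℝ → ℝ := fun R T => ∫ s in (1 : ℝ)..2, b (R * s) T with hA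
  have hAlow : ∀ R T, 0 ≤ R → b R T ≤ A R T := by
    intro R T hR
    have : ∫ s in (1 : ℝ)..2, b R T ≤ A R T := by
      refine intervalIntegral.integral_mono_on (by norm_num) (by simp) (hints T R hR) ?_
      intro s hs
      exact hmono T (by nlinarith [hs.1])
    simpa [show (2 : ℝ) - 1 = 1 by norm_num] using this
  have hAup : ∀ R T, 0 ≤ R → A R T ≤ b (2 * R) T := by
    intro R T hR
    have : A R T ≤ ∫ s in (1 : ℝ)..2, b (2 * R) T := by
      refine intervalIntegral.integral_mono_on (by norm_num) (hints T R hR) (by simp) ?_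
      intro s hs
      exact hmono T (by nlinarith [hs.2])
    simpa [show (2 : ℝ) - 1 = 1 by norm_num] using this
  have hAmono : ∀ T R R', 0 ≤ R → R ≤ R' → A R T ≤ A R' T := by
    intro T R R' hR hRR
    refine intervalIntegral.integral_mono_on (by norm_num) (hints T R hR)
      (hints T R' (hR.trans hRR)) fun s hs => hmono T ?_
    exact mul_le_mul_of_nonneg_right hRR (by linarith [hs.1])
  have hAant : ∀ R T T', 0 ≤ R → T ≤ T' → A R T' ≤ A R T := by
    intro R T T' hR hT
    exact intervalIntegral.integral_mono_on (by norm_num) (hints T' R hR) (hints T R hR)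
      fun s hs => hant _ _ _ hT
  have hAcont : ∀ T, ContinuousOn (fun R => A R T) (Ici 0) := by
    intro T R hR
    rcases eq_or_lt_of_le (show (0 : ℝ) ≤ R from hR) with rfl | hR0
    · rw [Metric.continuousWithinAt_iff]
      intro ε hε
      obtain ⟨δ, hδ, h⟩ := hbs (ε / 2) (half_pos hε)
      have h00 : A 0 T ≤ 0 := by
        refine le_of_forall_pos_le_add fun e he => ?_
        obtain ⟨δ, hδ, h⟩ := hbs e he
        linarith [hAup 0 T le_rfl, h (2 * 0) (by linarith) T]
      have h01 : 0 ≤ A 0 T := (hb0 0 T).trans (hAlow 0 T le_rfl)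
      refine ⟨δ / 2, half_pos hδ, fun x hx hxd => ?_⟩
      rw [Real.dist_eq, sub_zero, abs_of_nonneg (show (0 : ℝ) ≤ x from hx)] at hxd
      have h1 := hAup x T hx
      have h2 := h (2 * x) (by linarith) T
      have h3 := (hb0 x T).trans (hAlow x T hx)
      rw [Real.dist_eq, abs_lt]
      constructor <;> linarith
    · have hc : Continuous fun c => ∫ R in (0 : ℝ)..c, b R T :=
        intervalIntegral.continuous_primitive (hint T) 0
      have hc2 : Continuous fun R : ℝ => (∫ s in (0 : ℝ)..(R * 2), b s T) -
          ∫ s in (0 : ℝ)..(R * 1), b s T :=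
        (hc.comp (continuous_id.mul continuous_const)).sub
          (hc.comp (continuous_id.mul continuous_const))
      have hc3 : ContinuousAt (fun R : ℝ => R⁻¹ * ((∫ s in (0 : ℝ)..(R * 2), b s T) -
          ∫ s in (0 : ℝ)..(R * 1), b s T)) R :=
        (continuousAt_inv₀ hR0.ne').mul hc2.continuousAt
      refine (hc3.congr ?_).continuousWithinAt
      filter_upwards [Ioi_mem_nhds hR0] with r hr
      rw [intervalIntegral.integral_interval_sub_left (hint T _ _) (hint T _ _), hA]
      simp only
      rw [intervalIntegral.integral_comp_mul_left (fun s => b s T) (ne_of_gt hr), smul_eq_mul]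
  have hA0 : ∀ T, A 0 T = 0 := by
    intro T
    refine le_antisymm ?_ ((hb0 0 T).trans (hAlow 0 T le_rfl))
    refine le_of_forall_pos_le_add fun e he => ?_
    obtain ⟨δ, hδ, h⟩ := hbs e he
    linarith [hAup 0 T le_rfl, h (2 * 0) (by linarith) T]
  refine ⟨fun r t => A r t + r * Real.exp (-t), ⟨fun t ht => ⟨?_, ?_, ?_, ?_⟩, fun r hr => ⟨?_, ?_⟩⟩,
    ?_⟩
  · exact (hAcont t).add (continuous_id.mul continuous_const).continuousOn
  · intro r hr r' hr' hrr
    have h1 := hAmono t r r' hr hrr.le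
    have h2 := mul_lt_mul_of_pos_right hrr (Real.exp_pos (-t))
    simp only
    linarith
  · simp [hA0]
  · intro M
    refine ⟨|M| * Real.exp t, by positivity, ?_⟩
    have h1 := (hb0 _ t).trans (hAlow (|M| * Real.exp t) t (by positivity))
    have h2 : |M| * Real.exp t * Real.exp (-t) = |M| := by
      rw [mul_assoc, ← Real.exp_add]; simp
    simp only [h2]
    linarith [le_abs_self M]
  · intro t ht t' ht' htt
    have h1 := hAant r t t' hr htt
    have h2 : r * Real.exp (-t') ≤ r * Real.exp (-t) :=
      mul_le_mul_of_nonneg_left (Real.exp_le_exp.2 (by linarith)) hr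
    simp only
    linarith
  · have h1 : Tendsto (fun t => A r t) atTop (𝓝 0) := by
      rw [Metric.tendsto_atTop]
      intro ε hε
      obtain ⟨T0, h⟩ := hba (2 * r) (ε / 2) (half_pos hε)
      refine ⟨T0, fun T hT => ?_⟩
      have h1 := hAup r T hr
      have h3 := (hb0 r T).trans (hAlow r T hr)
      rw [Real.dist_eq, sub_zero, abs_of_nonneg h3]
      linarith [h T hT]
    have h2 : Tendsto (fun t : ℝ => r * Real.exp (-t)) atTop (𝓝 0) := by
      simpa using (Real.tendsto_exp_neg_atTop_nhds_zero).const_mul r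
    simpa using h1.add h2
  · intro r t y hr ht hQ
    have h1 : y ≤ b r t := le_csSup (hSb r t) (mem_insert_of_mem _ ⟨r, t, hr, le_rfl, ht, le_rfl, hQ⟩)
    have h2 := hAlow r t hr
    have h3 := mul_nonneg hr (Real.exp_pos (-t)).le
    linarith

lemma exists_classKInf_bound {Q : ℝ → ℝ → Prop}
    (hbdd : ∀ R, ∃ C, ∀ r y, 0 ≤ r → r ≤ R → Q r y → y ≤ C)
    (hstab : ∀ ε > 0, ∃ δ > 0, ∀ r y, 0 ≤ r → r ≤ δ → Q r y → y ≤ ε) :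
    ∃ ρ, ClassKInf ρ ∧ ∀ r y, 0 ≤ r → Q r y → y ≤ ρ r := by
  obtain ⟨β, hβ, h⟩ := exists_classKL_bound (Q := fun r t y => t = 0 ∧ Q r y)
    (fun R => (hbdd R).imp fun C hC r t y h0 h1 _ h3 => hC r y h0 h1 h3.2)
    (fun ε hε => (hstab ε hε).imp fun δ hδ => ⟨hδ.1, fun r t y h0 h1 _ h3 => hδ.2 r y h0 h1 h3.2⟩)
    (fun R ε hε => ⟨1, fun r t y _ _ _ h4 h5 => by linarith [h5.1]⟩)
  exact ⟨fun r => β r 0, hβ.1 0 le_rfl, fun r y hr hy => h r 0 y hr le_rfl ⟨rfl, hy⟩⟩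

lemma ClassKInf.nonneg {α : ℝ → ℝ} (hα : ClassKInf α) {r : ℝ} (hr : 0 ≤ r) : 0 ≤ α r := by
  have := hα.2.1.monotoneOn self_mem_Ici hr hr
  rwa [hα.2.2.1] at this

lemma ClassKInf.le_of_apply_le {α : ℝ → ℝ} (hα : ClassKInf α) {r s : ℝ} (hr : 0 ≤ r) (hs : 0 ≤ s)
    (h : α r ≤ α s) : r ≤ s := (hα.2.1.le_iff_le hr hs).1 h

lemma ClassKInf.mono {α : ℝ → ℝ} (hα : ClassKInf α) {r s : ℝ} (hr : 0 ≤ r) (hrs : r ≤ s) :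
    α r ≤ α s := hα.2.1.monotoneOn hr (hr.trans hrs) hrs

lemma ClassKInf.pos {α : ℝ → ℝ} (hα : ClassKInf α) {r : ℝ} (hr : 0 < r) : 0 < α r := by
  have := hα.2.1 self_mem_Ici hr.le hr
  rwa [hα.2.2.1] at this

lemma exists_le_near_zero {α : ℝ → ℝ} (hc : ContinuousOn α (Ici 0)) (h0 : α 0 = 0) {ε : ℝ}
    (hε : 0 < ε) : ∃ δ > 0, ∀ r, 0 ≤ r → r ≤ δ → α r ≤ ε := by
  obtain ⟨δ, hδ, h⟩ := Metric.continuousWithinAt_iff.1 (hc 0 self_mem_Ici) ε hε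
  refine ⟨δ / 2, half_pos hδ, fun r hr hrd => ?_⟩
  have := h hr (by rw [Real.dist_eq, sub_zero, abs_of_nonneg hr]; linarith)
  rw [h0, Real.dist_eq, sub_zero] at this
  exact (le_abs_self _).trans this.le

lemma exists_le_on_Icc {α : ℝ → ℝ} (hc : ContinuousOn α (Ici 0)) (R : ℝ) :
    ∃ C, ∀ r, 0 ≤ r → r ≤ R → α r ≤ C := by
  obtain ⟨C, hC⟩ := (isCompact_Icc (a := (0 : ℝ)) (b := R)).exists_bound_of_continuousOn
    (hc.mono fun y hy => hy.1)
  exact ⟨C, fun r h0 h1 => (le_abs_self _).trans (hC r ⟨h0, h1⟩)⟩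

/-- `y` is reachable from `z₀` after time `T` by decaying at rate `κ` up to the defect `C`,
measured by the density `q`, except for at most one jump `α`. -/
def DecaysTo (q α : ℝ → ℝ) (κ C z₀ T y : ℝ) : Prop :=
  0 < y ∧ ((y ≤ z₀ ∧ κ * T - C ≤ ∫ s in y..z₀, q s) ∨
    ∃ T₁ T₂ l w, T₁ + T₂ = T ∧ 0 < l ∧ l ≤ z₀ ∧ κ * T₁ - C ≤ (∫ s in l..z₀, q s) ∧
      w ≤ α l ∧ y ≤ w ∧ κ * T₂ - C ≤ ∫ s in y..w, q s)

section DecaysTo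

variable {q α : ℝ → ℝ} {κ C : ℝ}

lemma DecaysTo.exists_bound (hα : PosDef α) (R : ℝ) :
    ∃ B, 0 ≤ B ∧ ∀ z₀ T y, z₀ ≤ R → DecaysTo q α κ C z₀ T y → y ≤ B := by
  obtain ⟨B, hB⟩ := exists_le_on_Icc hα.1 R
  refine ⟨max (max R B) 0, le_max_right _ _, ?_⟩
  rintro z₀ T y hz ⟨hy, ⟨h1, -⟩ | ⟨T₁, T₂, l, w, -, hl, hlz, -, hw, hyw, -⟩⟩
  · exact le_max_of_le_left (le_max_of_le_left (h1.trans hz))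
  · exact le_max_of_le_left (le_max_of_le_right
      (hyw.trans (hw.trans (hB l hl.le (hlz.trans hz)))))

lemma DecaysTo.exists_stable (hα : PosDef α) {ε : ℝ} (hε : 0 < ε) :
    ∃ δ > 0, ∀ z₀ T y, z₀ ≤ δ → DecaysTo q α κ C z₀ T y → y ≤ ε := by
  obtain ⟨δ, hδ, h⟩ := exists_le_near_zero hα.1 hα.2.1 hε
  refine ⟨min δ ε, lt_min hδ hε, ?_⟩
  rintro z₀ T y hz ⟨hy, ⟨h1, -⟩ | ⟨T₁, T₂, l, w, -, hl, hlz, -, hw, hyw, -⟩⟩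
  · exact h1.trans (hz.trans (min_le_right _ _))
  · exact hyw.trans (hw.trans (h l hl.le (hlz.trans (hz.trans (min_le_left _ _)))))

lemma integral_mono_endpoints (hq : ContinuousOn q (Ioi 0)) (hqp : ∀ y, 0 < y → 0 ≤ q y)
    {a a' b b' : ℝ} (ha' : 0 < a') (haa : a' ≤ a) (hab : a ≤ b) (hbb : b ≤ b') :
    ∫ s in a..b, q s ≤ ∫ s in a'..b', q s := by
  refine intervalIntegral.integral_mono_interval haa hab hbb ?_
    (intervalIntegrable_of_continuousOn_Ioi hq ha' (ha'.trans_le (haa.trans (hab.trans hbb))))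
  rw [EventuallyLE, ae_restrict_iff' measurableSet_Ioc]
  exact Eventually.of_forall fun s hs => hqp s (ha'.trans hs.1)

lemma DecaysTo.exists_attractive (hα : PosDef α) (hq : ContinuousOn q (Ioi 0))
    (hqp : ∀ y, 0 < y → 0 ≤ q y) (hκ : 0 < κ) (R : ℝ) {ε : ℝ} (hε : 0 < ε) :
    ∃ T₀, ∀ z₀ T y, z₀ ≤ R → T₀ ≤ T → DecaysTo q α κ C z₀ T y → y ≤ ε := by
  obtain ⟨δ₀, hδ₀, hδα⟩ := exists_le_near_zero hα.1 hα.2.1 hε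
  obtain ⟨B, hB⟩ := exists_le_on_Icc hα.1 R
  set δ := min δ₀ ε
  have hδ : 0 < δ := lt_min hδ₀ hε
  set P := max R B
  -- a large decay certificate forces the endpoint below `δ`
  have key : ∀ z y T, z ≤ P → 0 < y → y ≤ z → (∫ s in δ..P, q s) + C < κ * T →
      κ * T - C ≤ (∫ s in y..z, q s) → y ≤ δ := by
    intro z y T hz hy hyz hT h
    by_contra hc
    have := integral_mono_endpoints hq hqp hδ (not_le.1 hc).le hyz hz
    linarith
  refine ⟨2 * ((|∫ s in δ..P, q s| + |C| + 1) / κ), ?_⟩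
  have hlarge : ∀ T, (|∫ s in δ..P, q s| + |C| + 1) / κ ≤ T → (∫ s in δ..P, q s) + C < κ * T := by
    intro T hT
    rw [div_le_iff₀ hκ] at hT
    linarith [le_abs_self (∫ s in δ..P, q s), le_abs_self C]
  have hpos : 0 ≤ (|∫ s in δ..P, q s| + |C| + 1) / κ := by positivity
  rintro z₀ T y hz hT ⟨hy, ⟨h1, h2⟩ | ⟨T₁, T₂, l, w, hTT, hl, hlz, hT₁, hw, hyw, hT₂⟩⟩
  · exact (key z₀ y T (hz.trans (le_max_left _ _)) hy h1 (hlarge T (by linarith)) h2).trans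
      (min_le_right _ _)
  · rcases le_total ((|∫ s in δ..P, q s| + |C| + 1) / κ) T₁ with h | h
    · have := key z₀ l T₁ (hz.trans (le_max_left _ _)) hl hlz (hlarge _ h) hT₁
      exact hyw.trans (hw.trans (hδα l hl.le (this.trans (min_le_left _ _))))
    · refine (key w y T₂ ?_ hy hyw (hlarge _ (by linarith)) hT₂).trans (min_le_right _ _)
      exact (hw.trans (hB l hl.le (hlz.trans hz))).trans (le_max_right _ _)

end DecaysTo

lemma nJumps_le_of_separated {γ : Set ℝ} {θ : ℝ} (hθ : 0 < θ)
    (hsep : ∀ s ∈ γ, ∀ t ∈ γ, s < t → θ ≤ t - s) {s t : ℝ} (hst : s ≤ t) :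
    (nJumps γ s t : ℝ) ≤ (t - s) / θ + 1 := by
  have hlt : ∀ r₁ ∈ γ ∩ Ioc s t, ∀ r₂ ∈ γ ∩ Ioc s t, r₁ < r₂ →
      ⌊(r₁ - s) / θ⌋₊ < ⌊(r₂ - s) / θ⌋₊ := by
    intro r₁ h1 r₂ h2 hr
    have h3 := hsep r₁ h1.1 r₂ h2.1 hr
    have h4 : (r₁ - s) / θ + 1 ≤ (r₂ - s) / θ := by
      rw [div_add_one hθ.ne']; gcongr; linarith
    have h5 : 0 ≤ (r₁ - s) / θ := div_nonneg (by linarith [h1.2.1]) hθ.le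
    have := Nat.floor_mono h4
    rw [Nat.floor_add_one h5] at this
    omega
  have h1 : nJumps γ s t ≤ (Finset.range (⌊(t - s) / θ⌋₊ + 1) : Set ℕ).ncard := by
    refine ncard_le_ncard_of_injOn (fun r => ⌊(r - s) / θ⌋₊) ?_ ?_ (Finset.finite_toSet _)
    · intro r hr
      simp only [Finset.coe_range, mem_Iio]
      refine Nat.lt_succ_of_le (Nat.floor_mono ?_)
      gcongr
      exact hr.2.2
    · intro r₁ h1 r₂ h2 h
      rcases lt_trichotomy r₁ r₂ with hr | hr | hr
      · exact absurd h (hlt _ h1 _ h2 hr).ne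
      · exact hr
      · exact absurd h (hlt _ h2 _ h1 hr).ne'
  rw [ncard_coe_finset, Finset.card_range] at h1
  have h2 : (⌊(t - s) / θ⌋₊ : ℝ) ≤ (t - s) / θ :=
    Nat.floor_le (div_nonneg (by linarith) hθ.le)
  have h3 : (nJumps γ s t : ℝ) ≤ ((⌊(t - s) / θ⌋₊ + 1 : ℕ) : ℝ) := by exact_mod_cast h1
  push_cast at h3
  linarith

lemma LocIntegrable.intervalIntegrable {p : ℝ → ℝ} (hp : LocIntegrable p) (a b : ℝ) :
    IntervalIntegrable p volume a b := by
  rw [intervalIntegrable_iff]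
  exact (hp (min a b) (max a b)).mono_set Ioc_subset_Icc_self

lemma floor_mul_le_integral {p : ℝ → ℝ} {θ m : ℝ} (hp : LocIntegrable p)
    (hpnn : ∀ t, 0 ≤ t → 0 ≤ p t) (hθ : 0 < θ) (hm : ∀ t, 0 ≤ t → m ≤ ∫ s in t..(t + θ), p s)
    {a b : ℝ} (ha : 0 ≤ a) (hab : a ≤ b) :
    (⌊(b - a) / θ⌋₊ : ℝ) * m ≤ ∫ s in a..b, p s := by
  have hN : ∀ N : ℕ, (N : ℝ) * m ≤ ∫ s in a..(a + N * θ), p s := by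
    intro N
    induction N with
    | zero => simp
    | succ N ih =>
      have h1 := hm (a + N * θ) (by positivity)
      have h2 := intervalIntegral.integral_add_adjacent_intervals
        (hp.intervalIntegrable a (a + N * θ))
        (hp.intervalIntegrable (a + N * θ) (a + N * θ + θ))
      have h3 : a + ((N + 1 : ℕ) : ℝ) * θ = a + N * θ + θ := by push_cast; ring
      rw [h3, ← h2]
      push_cast
      linarith
  refine (hN _).trans ?_
  have hf : (⌊(b - a) / θ⌋₊ : ℝ) * θ ≤ b - a := by
    rw [← le_div_iff₀ hθ]
    exact Nat.floor_le (div_nonneg (by linarith) hθ.le)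
  refine intervalIntegral.integral_mono_interval le_rfl (by simp; positivity) (by linarith) ?_
    (hp.intervalIntegrable a b)
  rw [EventuallyLE, ae_restrict_iff' measurableSet_Ioc]
  exact Eventually.of_forall fun s hs => hpnn s (ha.trans hs.1.le)

lemma exists_last_mem_Ioc {γ : Set ℝ} {s t : ℝ} (hfin : (γ ∩ Ioc s t).Finite)
    (hne : (γ ∩ Ioc s t).Nonempty) : ∃ τ ∈ γ ∩ Ioc s t, γ ∩ Ioc τ t = ∅ := by
  obtain ⟨τ, hτ, h⟩ := hfin.exists_maximalFor id _ hne
  refine ⟨τ, hτ, eq_empty_of_forall_notMem fun r hr => ?_⟩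
  have := h (j := r) ⟨hr.1, hτ.2.1.trans hr.2.1, hr.2.2⟩ hr.2.1.le
  exact absurd hr.2.1 (not_lt.2 this)

lemma exists_last_mem_Ioo {γ : Set ℝ} {s t : ℝ} (hfin : (γ ∩ Ioo s t).Finite)
    (hne : (γ ∩ Ioo s t).Nonempty) : ∃ τ ∈ γ ∩ Ioo s t, γ ∩ Ioo τ t = ∅ := by
  obtain ⟨τ, hτ, h⟩ := hfin.exists_maximalFor id _ hne
  refine ⟨τ, hτ, eq_empty_of_forall_notMem fun r hr => ?_⟩
  have := h (j := r) ⟨hr.1, hτ.2.1.trans hr.2.1, hr.2.2⟩ hr.2.1.le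
  exact absurd hr.2.1 (not_lt.2 this)

lemma exists_first_mem_Ioc {γ : Set ℝ} {s t : ℝ} (hfin : (γ ∩ Ioc s t).Finite)
    (hne : (γ ∩ Ioc s t).Nonempty) : ∃ τ ∈ γ ∩ Ioc s t, γ ∩ Ioo s τ = ∅ := by
  obtain ⟨τ, hτ, h⟩ := hfin.exists_minimalFor id _ hne
  refine ⟨τ, hτ, eq_empty_of_forall_notMem fun r hr => ?_⟩
  have := h (j := r) ⟨hr.1, hr.2.1, hr.2.2.le.trans hτ.2.2⟩ hr.2.2.le
  exact absurd hr.2.2 (not_lt.2 this)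

/-- Flow pieces and jumps of a positive trajectory chain up to a single decay certificate. -/
lemma decaysTo_of_chain {γ : Set ℝ} {q α z : ℝ → ℝ} {κ C s₀ t : ℝ} (hst : s₀ ≤ t)
    (hfin : (γ ∩ Ioc s₀ t).Finite) (hq : ContinuousOn q (Ioi 0))
    (hpos : ∀ s ∈ Icc s₀ t, 0 < z s)
    (hflow : ∀ a b, s₀ ≤ a → a ≤ b → b ≤ t → γ ∩ Ioc a b = ∅ →
      z b ≤ z a ∧ κ * (b - a) - C ≤ ∫ y in (z b)..(z a), q y)
    (hfirst : ∀ τ ∈ γ ∩ Ioc s₀ t, γ ∩ Ioo s₀ τ = ∅ →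
      ∃ l, 0 < l ∧ l ≤ z s₀ ∧ κ * (τ - s₀) - C ≤ (∫ y in l..(z s₀), q y) ∧ z τ ≤ α l)
    (hstep : ∀ a ∈ γ ∩ Ioc s₀ t, ∀ τ ∈ γ ∩ Ioc s₀ t, a < τ → γ ∩ Ioo a τ = ∅ →
      z τ ≤ z a ∧ κ * (τ - a) ≤ ∫ y in (z τ)..(z a), q y) :
    DecaysTo q α κ C (z s₀) (t - s₀) (z t) := by
  refine ⟨hpos t ⟨hst, le_rfl⟩, ?_⟩
  by_cases hne : (γ ∩ Ioc s₀ t).Nonempty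
  swap
  · exact Or.inl (hflow s₀ t le_rfl hst le_rfl (not_nonempty_iff_eq_empty.1 hne))
  right
  have hpos' : ∀ s ∈ γ ∩ Ioc s₀ t, 0 < z s := fun s hs => hpos s ⟨hs.2.1.le, hs.2.2⟩
  obtain ⟨τ₁, hτ₁, hτ₁'⟩ := exists_first_mem_Ioc hfin hne
  have hadd : ∀ {c d e}, 0 < c → 0 < d → 0 < e →
      (∫ y in c..d, q y) + (∫ y in d..e, q y) = ∫ y in c..e, q y := fun hc hd he =>
    intervalIntegral.integral_add_adjacent_intervals
      (intervalIntegrable_of_continuousOn_Ioi hq hc hd)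
      (intervalIntegrable_of_continuousOn_Ioi hq hd he)
  have hfirstle : ∀ τ ∈ γ ∩ Ioc s₀ t, τ₁ ≤ τ := by
    intro τ hτ
    by_contra hc
    exact (hτ₁' ▸ (⟨hτ.1, hτ.2.1, not_le.1 hc⟩ : τ ∈ γ ∩ Ioo s₀ τ₁) : τ ∈ (∅ : Set ℝ))
  have hjump : ∀ τ ∈ γ ∩ Ioc s₀ t, z τ ≤ z τ₁ ∧ κ * (τ - τ₁) ≤ ∫ y in (z τ)..(z τ₁), q y := by
    by_contra hcon
    push Not at hcon
    obtain ⟨τ, ⟨hτ, hbad⟩, hmin⟩ := (hfin.subset (t := {τ | τ ∈ γ ∩ Ioc s₀ t ∧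
      ¬ (z τ ≤ z τ₁ ∧ κ * (τ - τ₁) ≤ ∫ y in (z τ)..(z τ₁), q y)}) fun _ h => h.1).exists_minimalFor
      id _ (by obtain ⟨τ, h1, h2⟩ := hcon; exact ⟨τ, h1, fun h => not_lt.2 h.2 (h2 h.1)⟩)
    apply hbad
    rcases (hfirstle τ hτ).eq_or_lt with rfl | hlt
    · simp
    have hsub : γ ∩ Ioo s₀ τ ⊆ γ ∩ Ioc s₀ t := fun r hr =>
      ⟨hr.1, hr.2.1, hr.2.2.le.trans hτ.2.2⟩
    obtain ⟨a, ha, ha'⟩ := exists_last_mem_Ioo (hfin.subset hsub) ⟨τ₁, hτ₁.1, hτ₁.2.1, hlt⟩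
    have hgood : z a ≤ z τ₁ ∧ κ * (a - τ₁) ≤ ∫ y in (z a)..(z τ₁), q y := by
      by_contra hc
      have := hmin (j := a) ⟨hsub ha, hc⟩ ha.2.2.le
      exact absurd ha.2.2 (not_lt.2 this)
    obtain ⟨h1, h2⟩ := hstep a (hsub ha) τ hτ ha.2.2 ha'
    refine ⟨h1.trans hgood.1, ?_⟩
    rw [← hadd (hpos' τ hτ) (hpos' a (hsub ha)) (hpos' τ₁ hτ₁)]
    linarith [hgood.2]
  obtain ⟨τ₂, hτ₂, hτ₂'⟩ := exists_last_mem_Ioc hfin hne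
  obtain ⟨l, hl, hlz, hl', hα⟩ := hfirst τ₁ hτ₁ hτ₁'
  obtain ⟨h1, h2⟩ := hflow τ₂ t hτ₂.2.1.le hτ₂.2.2 le_rfl hτ₂'
  obtain ⟨h3, h4⟩ := hjump τ₂ hτ₂
  refine ⟨τ₁ - s₀, t - τ₁, l, z τ₁, by ring, hl, hlz, hl', hα, h1.trans h3, ?_⟩
  rw [← hadd (hpos t ⟨hst, le_rfl⟩) (hpos' τ₂ hτ₂) (hpos' τ₁ hτ₁)]
  linarith

lemma exists_pos_le_of_finite {ι : Type*} [Finite ι] (e : ι → ℝ) (he : ∀ i, 0 < e i) :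
    ∃ c > 0, ∀ i, c ≤ e i := by
  rcases isEmpty_or_nonempty ι with h | h
  · exact ⟨1, one_pos, fun i => isEmptyElim i⟩
  · obtain ⟨i, hi⟩ := Finite.exists_min e
    exact ⟨e i, he i, hi⟩

section Solutions

variable {n m : ℕ} {Ic Id : Type*}

lemma SwSignal.σ1_eq_of_inter_Ioc_eq_empty (σ : SwSignal Ic Id) {a b : ℝ} (ha : 0 ≤ a)
    (hab : σ.γ ∩ Ioc a b = ∅) : ∀ s ∈ Icc a b, σ.σ1 s = σ.σ1 a := by
  obtain ⟨b', hb', he⟩ : ∃ b' > b, σ.γ ∩ Ioo b b' = ∅ := by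
    have hfin : (σ.γ ∩ Ioc b (b + 1)).Finite :=
      (σ.impulse.2 (b + 1)).subset fun r hr => ⟨hr.1, hr.2.2⟩
    by_cases hne : (σ.γ ∩ Ioc b (b + 1)).Nonempty
    · obtain ⟨τ, hτ, h⟩ := exists_first_mem_Ioc hfin hne
      exact ⟨τ, hτ.2.1, h⟩
    · rw [not_nonempty_iff_eq_empty] at hne
      exact ⟨b + 1, by linarith, eq_empty_of_subset_empty
        (hne ▸ inter_subset_inter_right _ Ioo_subset_Ioc_self)⟩
  intro s hs
  refine σ.const1 a b' ha ?_ s ⟨hs.1, hs.2.trans_lt hb'⟩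
  refine eq_empty_of_forall_notMem fun r hr => ?_
  rcases le_or_gt r b with h | h
  · exact (hab ▸ (⟨hr.2, hr.1.1, h⟩ : r ∈ σ.γ ∩ Ioc a b) : r ∈ (∅ : Set ℝ))
  · exact (he ▸ (⟨hr.2, h, hr.1.2⟩ : r ∈ σ.γ ∩ Ioo b b') : r ∈ (∅ : Set ℝ))

lemma IsImpulseSeq.exists_lt_inter_Ioo_eq_empty {γ : Set ℝ} (hγ : IsImpulseSeq γ) {s τ : ℝ}
    (hs : s < τ) : ∃ a, s ≤ a ∧ a < τ ∧ γ ∩ Ioo a τ = ∅ := by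
  have hfin : (γ ∩ Ioo s τ).Finite := (hγ.2 τ).subset fun r hr => ⟨hr.1, hr.2.2.le⟩
  by_cases hne : (γ ∩ Ioo s τ).Nonempty
  · obtain ⟨a, ha, h⟩ := exists_last_mem_Ioo hfin hne
    exact ⟨a, ha.2.1.le, ha.2.2, h⟩
  · exact ⟨s, le_rfl, hs, not_nonempty_iff_eq_empty.1 hne⟩

lemma inter_Ioc_eq_empty_of_Ioo {γ : Set ℝ} {a b τ : ℝ} (h : γ ∩ Ioo a τ = ∅) (hb : b < τ) :
    γ ∩ Ioc a b = ∅ :=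
  eq_empty_of_subset_empty fun _ hr => h ▸ ⟨hr.1, hr.2.1, hr.2.2.trans_lt hb⟩

variable {F : Ic → ℝ → Stt n → Stt m → Stt n} {G : Id → ℝ → Stt n → Stt m → Stt n}
  {σ : SwSignal Ic Id} {v : Ic → ℝ → Stt n → ℝ}
  {t₀ : ℝ} {x₀ : Stt n} {u : ℝ → Stt m} {T : EReal} {x : ℝ → Stt n}

/-- Between impulses a solution of the switched system solves the flow of the active mode. -/
lemma IsSolution.flow_mode (ht₀ : 0 ≤ t₀)
    (hsol : IsSolution σ.γ (swF F σ) (swG G σ) t₀ x₀ u T x) {a b : ℝ} (ha : t₀ ≤ a) (hab : a ≤ b)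
    (hbT : (b : EReal) < T) (he : σ.γ ∩ Ioc a b = ∅) :
    IntegrableOn (fun s => F (σ.σ1 a) s (x s) (u s)) (Icc a b) ∧
      ∀ s ∈ Icc a b, x s = x a + ∫ r in a..s, F (σ.σ1 a) r (x r) (u r) := by
  have hσ := σ.σ1_eq_of_inter_Ioc_eq_empty (ht₀.trans ha) he
  constructor
  · refine (hsol.flow a b ha hab hbT (by rwa [inter_comm])).1.congr_fun (fun s hs => ?_)
      measurableSet_Icc
    simp only [swF, hσ s hs]
  · intro s hs
    have h := (hsol.flow a s ha hs.1 ((EReal.coe_le_coe_iff.2 hs.2).trans_lt hbT) (by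
      rw [inter_comm]
      exact eq_empty_of_subset_empty (he ▸ inter_subset_inter_right _ (Ioc_subset_Ioc_right hs.2)))).2
    rw [h]
    congr 1
    refine intervalIntegral.integral_congr fun r hr => ?_
    rw [uIcc_of_le hs.1] at hr
    simp only [swF, hσ r ⟨hr.1, hr.2.trans hs.2⟩]

lemma LocLipschitzOn.continuousOn {k : ℕ} {V : ℝ → Stt k → ℝ}
    (hV : LocLipschitzOn (Ici (0 : ℝ) ×ˢ (univ : Set (Stt k)))
      (fun q : ℝ × Stt k => V q.1 q.2)) :
    ContinuousOn (fun q : ℝ × Stt k => V q.1 q.2) (Ici (0 : ℝ) ×ˢ (univ : Set (Stt k))) :=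
  LocallyLipschitzOn.continuousOn fun y hy => hV y hy

/-- At an impulse time the active Lyapunov function has a left limit. -/
lemma IsSolution.exists_leftLimit (ht₀ : 0 ≤ t₀)
    (hv : ∀ i, LocLipschitzOn (Ici (0 : ℝ) ×ˢ (univ : Set (Stt n)))
      (fun q : ℝ × Stt n => v i q.1 q.2))
    (hsol : IsSolution σ.γ (swF F σ) (swG G σ) t₀ x₀ u T x) {τ : ℝ} (hτ : τ ∈ σ.γ) (h : t₀ < τ)
    (hT : (τ : EReal) < T) :
    ∃ ξ : Stt n, Tendsto (fun s => v (σ.σ1 s) s (x s)) (𝓝[<] τ) (𝓝 (v (σ.σ1m τ) τ ξ)) ∧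
      x τ = ξ + G (σ.σ2 τ) τ ξ (u τ) := by
  obtain ⟨ξ, hξ, hx⟩ := hsol.jump τ hτ h hT
  refine ⟨ξ, ?_, hx⟩
  have h1 : Tendsto (fun s => (s, x s)) (𝓝[<] τ)
      (𝓝[Ici (0 : ℝ) ×ˢ (univ : Set (Stt n))] (τ, ξ)) := by
    refine tendsto_nhdsWithin_iff.2 ⟨(tendsto_id.mono_left nhdsWithin_le_nhds).prodMk_nhds hξ, ?_⟩
    filter_upwards [mem_nhdsWithin_of_mem_nhds (Ioi_mem_nhds (ht₀.trans_lt h))] with s hs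
    exact ⟨(show (0:ℝ) ≤ s from le_of_lt hs), mem_univ _⟩
  have h2 := ((hv (σ.σ1m τ)).continuousOn (τ, ξ) ⟨ht₀.trans h.le, mem_univ _⟩).tendsto.comp h1
  refine h2.congr' ?_
  filter_upwards [σ.leftlim τ hτ] with s hs
  simp [hs]

/-- Away from impulse times the active Lyapunov function is left-continuous. -/
lemma IsSolution.tendsto_left (ht₀ : 0 ≤ t₀)
    (hv : ∀ i, LocLipschitzOn (Ici (0 : ℝ) ×ˢ (univ : Set (Stt n)))
      (fun q : ℝ × Stt n => v i q.1 q.2))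
    (hsol : IsSolution σ.γ (swF F σ) (swG G σ) t₀ x₀ u T x) {τ : ℝ} (hτ : τ ∉ σ.γ) (h : t₀ < τ)
    (hT : (τ : EReal) < T) :
    Tendsto (fun s => v (σ.σ1 s) s (x s)) (𝓝[<] τ) (𝓝 (v (σ.σ1 τ) τ (x τ))) := by
  obtain ⟨a, ha, haτ, he⟩ := σ.impulse.exists_lt_inter_Ioo_eq_empty h
  have he' : σ.γ ∩ Ioc a τ = ∅ := by
    refine eq_empty_of_forall_notMem fun r hr => ?_
    rcases hr.2.2.eq_or_lt with rfl | hlt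
    · exact hτ hr.1
    · exact (he ▸ (⟨hr.1, hr.2.1, hlt⟩ : r ∈ σ.γ ∩ Ioo a τ) : r ∈ (∅ : Set ℝ))
  have hσ := σ.σ1_eq_of_inter_Ioc_eq_empty (ht₀.trans ha) he'
  obtain ⟨hd, hx⟩ := hsol.flow_mode ht₀ ha haτ.le hT he'
  have hac := (absolutelyContinuous_along (ht₀.trans ha) haτ.le (hv (σ.σ1 a)) hd hx).continuousOn
  rw [uIcc_of_le haτ.le] at hac
  have h1 := (hac τ ⟨haτ.le, le_rfl⟩).tendsto
  rw [← nhdsWithin_Ioo_eq_nhdsLT haτ, hσ τ ⟨haτ.le, le_rfl⟩]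
  refine (h1.mono_left (nhdsWithin_mono _ Ioo_subset_Icc_self)).congr' ?_
  filter_upwards [self_mem_nhdsWithin] with s hs
  rw [hσ s ⟨hs.1.le, hs.2.le⟩]

lemma IsSolution.decaysTo_of_undisturbed {χ αb q : ℝ → ℝ} {p φb : Ic → ℝ → ℝ} {θ : Ic → ℝ}
    {κ C : ℝ}
    (hv : ∀ i, LocLipschitzOn (Ici (0 : ℝ) ×ˢ (univ : Set (Stt n)))
      (fun q : ℝ × Stt n => v i q.1 q.2))
    (hp : ∀ i, LocIntegrable (p i)) (hpnn : ∀ i t, 0 ≤ t → 0 ≤ p i t)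
    (hφc : ∀ i, ContinuousOn (φb i) (Ioi 0)) (hφp : ∀ i y, 0 < y → 0 < φb i y)
    (hαp : ∀ y, 0 < y → 0 < αb y)
    (hflow : ∀ i t ξ μ, 0 ≤ t → χ ‖μ‖ ≤ v i t ξ →
      DiniAlong (F i) (v i) t ξ μ ≤ -(p i t * φb i (v i t ξ)))
    (hjump : ∀ ι i j t ξ μ, 0 ≤ t → χ ‖μ‖ ≤ v ι t ξ →
      v i t (ξ + G j t ξ μ) ≤ αb (v ι t ξ))
    (hq : ContinuousOn q (Ioi 0)) (hqφ : ∀ i y, 0 < y → (φb i y)⁻¹ ≤ q y) (hκ : 0 < κ)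
    (hflowC : ∀ i a b, 0 ≤ a → a ≤ b → κ * (b - a) - C ≤ ∫ s in a..b, p i s)
    (hstepC : ∀ i a b l, 0 ≤ a → θ i ≤ b - a → 0 < l →
      κ * (b - a) ≤ (∫ s in a..b, p i s) - ∫ y in l..(αb l), (φb i y)⁻¹)
    (hdwell : ∀ a ∈ σ.γ, ∀ τ ∈ σ.γ, a < τ → θ (σ.σ1 a) ≤ τ - a)
    (ht₀ : 0 ≤ t₀) (hsol : IsSolution σ.γ (swF F σ) (swG G σ) t₀ x₀ u T x)
    {s₀ t c : ℝ} (hs₀ : t₀ ≤ s₀) (hst : s₀ ≤ t) (htT : (t : EReal) < T) (hc : 0 ≤ c)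
    (hua : ∀ᵐ s, s ∈ Ioc s₀ t → χ ‖u s‖ ≤ c) (huj : ∀ s ∈ σ.γ ∩ Ioc s₀ t, χ ‖u s‖ ≤ c)
    (hz : ∀ s ∈ Ioc s₀ t, c < v (σ.σ1 s) s (x s))
    (hzl : ∀ τ ∈ σ.γ ∩ Ioc s₀ t, ∀ l,
      Tendsto (fun s => v (σ.σ1 s) s (x s)) (𝓝[<] τ) (𝓝 l) → c < l)
    (h0 : s₀ < t ∨ 0 < v (σ.σ1 s₀) s₀ (x s₀)) :
    DecaysTo q αb κ C (v (σ.σ1 s₀) s₀ (x s₀)) (t - s₀) (v (σ.σ1 t) t (x t)) := by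
  set z : ℝ → ℝ := fun s => v (σ.σ1 s) s (x s) with hzdef
  have hlt : ∀ s ≤ t, (s : EReal) < T := fun s hs => (EReal.coe_le_coe_iff.2 hs).trans_lt htT
  have hw : ∀ i, ContinuousOn (fun y => (φb i y)⁻¹) (Ioi 0) := fun i =>
    (hφc i).inv₀ fun y hy => (hφp i y hy).ne'
  have hwp : ∀ i y, 0 < y → 0 < (φb i y)⁻¹ := fun i y hy => inv_pos.2 (hφp i y hy)
  have hpiece : ∀ a b, s₀ ≤ a → a ≤ b → b ≤ t → σ.γ ∩ Ioc a b = ∅ → 0 < z b →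
      z b ≤ z a ∧ ∫ s in a..b, p (σ.σ1 a) s ≤ ∫ y in (z b)..(z a), (φb (σ.σ1 a) y)⁻¹ := by
    intro a b ha hab hb he hzb
    have ha0 : 0 ≤ a := ht₀.trans (hs₀.trans ha)
    have hσ := σ.σ1_eq_of_inter_Ioc_eq_empty ha0 he
    obtain ⟨hd, hx⟩ := hsol.flow_mode ht₀ (hs₀.trans ha) hab (hlt b hb) he
    have hσb := hσ b ⟨hab, le_rfl⟩
    have h1 : z b = v (σ.σ1 a) b (x b) := by simp only [hzdef, hσb]
    rw [h1] at hzb ⊢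
    have hgt : ∀ s ∈ Ioc a b, c < v (σ.σ1 a) s (x s) := fun s hs => by
      have := hz s ⟨ha.trans_lt hs.1, hs.2.trans hb⟩
      rwa [hσ s ⟨hs.1.le, hs.2⟩] at this
    refine integral_le_of_deriv_le hab (absolutelyContinuous_along ha0 hab (hv _) hd hx)
      ((hp _).intervalIntegrable a b) (fun s hs => hpnn _ s (ha0.trans hs.1)) (hφc _) (hφp _)
      (fun s hs => hc.trans_lt (hgt s hs)) hzb ?_
    filter_upwards [deriv_along_eq_dini ha0 hab (hv _) hd hx, hua] with s h2 h3 hs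
    rw [h2 hs]
    exact hflow _ _ _ _ (ha0.trans hs.1.le)
      ((h3 ⟨ha.trans_lt hs.1, hs.2.le.trans hb⟩).trans (hgt s ⟨hs.1, hs.2.le⟩).le)
  have hzpos : ∀ s ∈ Icc s₀ t, 0 < z s := by
    intro s hs
    rcases hs.1.eq_or_lt with rfl | hlt'
    · rcases h0 with h0 | h0
      · have hfin : (σ.γ ∩ Ioc s₀ t).Finite := (σ.impulse.2 t).subset fun r hr => ⟨hr.1, hr.2.2⟩
        obtain ⟨b, hb1, hb2, hb3⟩ : ∃ b, s₀ < b ∧ b ≤ t ∧ σ.γ ∩ Ioc s₀ b = ∅ := by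
          by_cases hne : (σ.γ ∩ Ioc s₀ t).Nonempty
          · obtain ⟨τ, hτ, h⟩ := exists_first_mem_Ioc hfin hne
            exact ⟨(s₀ + τ) / 2, by linarith [hτ.2.1], by linarith [hτ.2.1, hτ.2.2],
              inter_Ioc_eq_empty_of_Ioo h (by linarith [hτ.2.1])⟩
          · exact ⟨t, h0, le_rfl, not_nonempty_iff_eq_empty.1 hne⟩
        have hzb := hc.trans_lt (hz b ⟨hb1, hb2⟩)
        exact hzb.trans_le (hpiece s₀ b le_rfl hb1.le hb2 hb3 hzb).1
      · exact h0
    · exact hc.trans_lt (hz s ⟨hlt', hs.2⟩)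
  have hupto : ∀ a τ, s₀ ≤ a → a < τ → τ ≤ t → τ ∈ σ.γ → σ.γ ∩ Ioo a τ = ∅ →
      ∃ l, 0 < l ∧ l ≤ z a ∧
        ∫ s in a..τ, p (σ.σ1 a) s ≤ (∫ y in l..(z a), (φb (σ.σ1 a) y)⁻¹) ∧ z τ ≤ αb l := by
    intro a τ ha haτ hτt hτ he
    have hτI : τ ∈ σ.γ ∩ Ioc s₀ t := ⟨hτ, ha.trans_lt haτ, hτt⟩
    obtain ⟨ξ, hl, hxτ⟩ := hsol.exists_leftLimit ht₀ hv hτ (hs₀.trans_lt hτI.2.1) (hlt τ hτt)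
    have hcl := hzl τ hτI _ hl
    set l := v (σ.σ1m τ) τ ξ with hldef
    have hl0 : 0 < l := hc.trans_lt hcl
    have hza : 0 < z a := hzpos a ⟨ha, haτ.le.trans hτt⟩
    have hev : ∀ᶠ b in 𝓝[<] τ, z b ≤ z a ∧
        ∫ s in a..b, p (σ.σ1 a) s ≤ ∫ y in (z b)..(z a), (φb (σ.σ1 a) y)⁻¹ := by
      filter_upwards [Ioo_mem_nhdsLT haτ] with b hb
      exact hpiece a b ha hb.1.le (hb.2.le.trans hτt) (inter_Ioc_eq_empty_of_Ioo he hb.2)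
        (hzpos b ⟨ha.trans hb.1.le, hb.2.le.trans hτt⟩)
    refine ⟨l, hl0, le_of_tendsto hl (hev.mono fun _ h => h.1), ?_, ?_⟩
    · have hP : Tendsto (fun b => ∫ s in a..b, p (σ.σ1 a) s) (𝓝[<] τ)
          (𝓝 (∫ s in a..τ, p (σ.σ1 a) s)) :=
        ((intervalIntegral.continuous_primitive ((hp _).intervalIntegrable) a).tendsto τ).mono_left
          nhdsWithin_le_nhds
      have hIl : ContinuousAt (fun r => ∫ y in r..(z a), (φb (σ.σ1 a) y)⁻¹) l := by
        refine (intervalIntegral.integral_hasDerivAt_left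
          (intervalIntegrable_of_continuousOn_Ioi (hw _) hl0 hza) ?_
          ((hw _).continuousAt (Ioi_mem_nhds hl0))).continuousAt
        exact (hw _).stronglyMeasurableAtFilter isOpen_Ioi _ hl0
      exact le_of_tendsto_of_tendsto hP (hIl.tendsto.comp hl) (hev.mono fun _ h => h.2)
    · have hτ0 : 0 ≤ τ := ht₀.trans (hs₀.trans hτI.2.1.le)
      simp only [hzdef, hxτ]
      exact hjump _ _ _ _ _ _ hτ0 ((huj τ hτI).trans hcl.le)
  have hwq : ∀ i c d, 0 < c → c ≤ d → ∫ y in c..d, (φb i y)⁻¹ ≤ ∫ y in c..d, q y := by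
    intro i c d hc' hcd
    exact intervalIntegral.integral_mono_on hcd
      (intervalIntegrable_of_continuousOn_Ioi (hw i) hc' (hc'.trans_le hcd))
      (intervalIntegrable_of_continuousOn_Ioi hq hc' (hc'.trans_le hcd))
      fun y hy => hqφ i y (hc'.trans_le hy.1)
  refine decaysTo_of_chain hst ((σ.impulse.2 t).subset fun r hr => ⟨hr.1, hr.2.2⟩) hq hzpos
    ?_ ?_ ?_
  · intro a b ha hab hb he
    have hzb := hzpos b ⟨ha.trans hab, hb⟩
    obtain ⟨h1, h2⟩ := hpiece a b ha hab hb he hzb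
    exact ⟨h1, (hflowC _ a b (ht₀.trans (hs₀.trans ha)) hab).trans
      (h2.trans (hwq _ _ _ hzb h1))⟩
  · intro τ hτ he
    obtain ⟨l, hl, hlz, h1, h2⟩ := hupto s₀ τ le_rfl hτ.2.1 hτ.2.2 hτ.1 he
    exact ⟨l, hl, hlz, (hflowC _ s₀ τ (ht₀.trans hs₀) hτ.2.1.le).trans
      (h1.trans (hwq _ _ _ hl hlz)), h2⟩
  · intro a ha τ hτ haτ he
    obtain ⟨l, hl, hlz, h1, h2⟩ := hupto a τ ha.2.1.le haτ hτ.2.2 hτ.1 he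
    have hza := hl.trans_le hlz
    have hzτ := hzpos τ ⟨hτ.2.1.le, hτ.2.2⟩
    have hαl := hαp l hl
    have h3 := hstepC (σ.σ1 a) a τ l (ht₀.trans (hs₀.trans ha.2.1.le))
      (hdwell a ha.1 τ hτ.1 haτ) hl
    have h4 := intervalIntegral.integral_interval_sub_left
      (intervalIntegrable_of_continuousOn_Ioi (hw (σ.σ1 a)) hl hza)
      (intervalIntegrable_of_continuousOn_Ioi (hw (σ.σ1 a)) hl hαl)
    have h5 : κ * (τ - a) ≤ ∫ y in (αb l)..(z a), (φb (σ.σ1 a) y)⁻¹ := by linarith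
    have h6 : αb l < z a := by
      by_contra hcon
      have h7 : 0 ≤ ∫ y in (z a)..(αb l), (φb (σ.σ1 a) y)⁻¹ :=
        intervalIntegral.integral_nonneg (not_lt.1 hcon)
          fun y hy => (hwp _ y (hza.trans_le hy.1)).le
      rw [intervalIntegral.integral_symm] at h7
      have := mul_pos hκ (sub_pos.2 haτ)
      linarith
    have h8 := h2.trans h6.le
    refine ⟨h8, h5.trans ((integral_mono_endpoints (hw _) (fun y hy => (hwp _ y hy).le) hzτ h2
      h6.le le_rfl).trans (hwq _ _ _ hzτ h8))⟩

end Solutions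

section InputNorm

variable {m : ℕ} {γ : Set ℝ} {u : ℝ → Stt m} {s t : ℝ}

lemma inputNorm_nonneg : 0 ≤ inputNorm γ u (Ioc s t) :=
  le_max_of_le_right (Real.sSup_nonneg (by rintro _ ⟨r, -, rfl⟩; exact norm_nonneg _))

lemma norm_le_inputNorm_of_mem (hγ : IsImpulseSeq γ) {r : ℝ} (hr : r ∈ γ ∩ Ioc s t) :
    ‖u r‖ ≤ inputNorm γ u (Ioc s t) := by
  refine le_max_of_le_right (le_csSup ?_ (mem_image_of_mem _ hr))
  exact (((hγ.2 t).subset fun r hr => ⟨hr.1, hr.2.2⟩).image _).bddAbove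

lemma IsInput.ae_norm_le_inputNorm (hu : IsInput u) (hs : 0 ≤ s) :
    ∀ᵐ r, r ∈ Ioc s t → ‖u r‖ ≤ inputNorm γ u (Ioc s t) := by
  rw [← ae_restrict_iff' measurableSet_Ioc]
  obtain ⟨C, hC⟩ := hu.2 t
  have hb : IsBoundedUnder (· ≤ ·) (ae (volume.restrict (Ioc s t))) fun r => ‖u r‖ := by
    refine ⟨C, ?_⟩
    rw [eventually_map, ae_restrict_iff' measurableSet_Ioc]
    filter_upwards [hC] with r hr h
    exact hr ⟨hs.trans h.1.le, h.2⟩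
  filter_upwards [ae_le_essSup hb] with r hr
  exact hr.trans (le_max_left _ _)

end InputNorm

/-- Either the trajectory stays above the level `c` on the whole interval, or it does so after a
last time at which the value or its left limit is at most `c`. -/
lemma exists_last_le_or {γ : Set ℝ} {z : ℝ → ℝ} {t₀ t : ℝ} (hγ : IsImpulseSeq γ) (c : ℝ)
    (hcont : ∀ τ ∈ Ioc t₀ t, τ ∉ γ → Tendsto z (𝓝[<] τ) (𝓝 (z τ))) (ht : t₀ ≤ t) :
    ∃ s ∈ Icc t₀ t, ((s = t₀ ∧ c < z s) ∨ z s ≤ c ∨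
        (s ∈ γ ∩ Ioc t₀ t ∧ ∀ l, Tendsto z (𝓝[<] s) (𝓝 l) → l ≤ c)) ∧
      (∀ r ∈ Ioc s t, c < z r) ∧
      ∀ τ ∈ γ ∩ Ioc s t, ∀ l, Tendsto z (𝓝[<] τ) (𝓝 l) → c < l := by
  set S : Set ℝ := {s | s ∈ Icc t₀ t ∧ (z s ≤ c ∨
    (s ∈ γ ∩ Ioc t₀ t ∧ ∀ l, Tendsto z (𝓝[<] s) (𝓝 l) → l ≤ c))} with hS
  have hafter : ∀ s, t₀ ≤ s → (∀ r ∈ Ioc s t, r ∉ S) → (∀ r ∈ Ioc s t, c < z r) ∧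
      ∀ τ ∈ γ ∩ Ioc s t, ∀ l, Tendsto z (𝓝[<] τ) (𝓝 l) → c < l := by
    intro s hs h
    refine ⟨fun r hr => ?_, fun τ hτ l hl => ?_⟩
    · by_contra hcon
      exact h r hr ⟨⟨hs.trans hr.1.le, hr.2⟩, Or.inl (not_lt.1 hcon)⟩
    · by_contra hcon
      refine h τ hτ.2 ⟨⟨hs.trans hτ.2.1.le, hτ.2.2⟩,
        Or.inr ⟨⟨hτ.1, hs.trans_lt hτ.2.1, hτ.2.2⟩, fun l' hl' => ?_⟩⟩
      rw [tendsto_nhds_unique hl' hl]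
      exact not_lt.1 hcon
  rcases S.eq_empty_or_nonempty with hne | hne
  · obtain ⟨h1, h2⟩ := hafter t₀ le_rfl fun r _ => by simp [hne]
    refine ⟨t₀, ⟨le_rfl, ht⟩, ?_, h1, h2⟩
    rcases lt_or_ge c (z t₀) with h | h
    · exact Or.inl ⟨rfl, h⟩
    · exact Or.inr (Or.inl h)
  · have hbdd : BddAbove S := ⟨t, fun s hs => hs.1.2⟩
    have hmem : sSup S ∈ S := by
      by_contra hnot
      have hle : sSup S ≤ t := csSup_le hne fun s hs => hs.1.2
      obtain ⟨s₁, hs₁⟩ := hne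
      have hlt : ∀ s ∈ S, s < sSup S := fun s hs =>
        (le_csSup hbdd hs).lt_of_ne fun h => hnot (h ▸ hs)
      have hI : sSup S ∈ Ioc t₀ t := ⟨hs₁.1.1.trans_lt (hlt s₁ hs₁), hle⟩
      obtain ⟨a, ha, haS, he⟩ := hγ.exists_lt_inter_Ioo_eq_empty hI.1
      have hfreq : ∃ᶠ s in 𝓝[<] (sSup S), z s ≤ c := by
        rw [(nhdsLT_basis_of_exists_lt ⟨a, haS⟩).frequently_iff]
        intro b hb
        obtain ⟨s, hs, hbs⟩ := exists_lt_of_lt_csSup ⟨s₁, hs₁⟩ (max_lt hb haS)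
        refine ⟨s, ⟨(le_max_left _ _).trans_lt hbs, hlt s hs⟩, ?_⟩
        rcases hs.2 with h | h
        · exact h
        · exact ((he ▸ (⟨h.1.1, (le_max_right _ _).trans_lt hbs, hlt s hs⟩ :
            s ∈ γ ∩ Ioo a (sSup S))) : s ∈ (∅ : Set ℝ)).elim
      have hlim : ∀ l, Tendsto z (𝓝[<] (sSup S)) (𝓝 l) → l ≤ c := fun l hl =>
        le_of_tendsto_of_frequently hl hfreq
      refine hnot ⟨⟨hI.1.le, hI.2⟩, ?_⟩
      by_cases hγS : sSup S ∈ γ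
      · exact Or.inr ⟨⟨hγS, hI⟩, hlim⟩
      · exact Or.inl (hlim _ (hcont _ hI hγS))
    obtain ⟨h1, h2⟩ := hafter (sSup S) hmem.1.1 fun r hr hrS => hr.1.not_ge (le_csSup hbdd hrS)
    exact ⟨sSup S, hmem.1, Or.inr hmem.2, h1, h2⟩

section DwellTime

variable {n m : ℕ} {Ic Id : Type*}

variable {F : Ic → ℝ → Stt n → Stt m → Stt n} {G : Id → ℝ → Stt n → Stt m → Stt n}
  {σ : SwSignal Ic Id} {v : Ic → ℝ → Stt n → ℝ}
  {t₀ : ℝ} {x₀ : Stt n} {u : ℝ → Stt m} {T : EReal} {x : ℝ → Stt n}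

/-- Along a solution, either the decay estimate holds since the initial time, or it holds since a
time at which the Lyapunov function is bounded in terms of the input. -/
lemma IsSolution.decaysTo_or_le {χ π αb q : ℝ → ℝ} {p φb : Ic → ℝ → ℝ} {θ : Ic → ℝ}
    {κ C : ℝ} (hχ : ClassKInf χ) (hπ : ClassKInf π)
    (hv : ∀ i, LocLipschitzOn (Ici (0 : ℝ) ×ˢ (univ : Set (Stt n)))
      (fun q : ℝ × Stt n => v i q.1 q.2))
    (hvnn : ∀ i t ξ, 0 ≤ t → 0 ≤ v i t ξ)
    (hp : ∀ i, LocIntegrable (p i)) (hpnn : ∀ i t, 0 ≤ t → 0 ≤ p i t)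
    (hφc : ∀ i, ContinuousOn (φb i) (Ioi 0)) (hφp : ∀ i y, 0 < y → 0 < φb i y)
    (hαp : ∀ y, 0 < y → 0 < αb y)
    (hflow : ∀ i t ξ μ, 0 ≤ t → χ ‖μ‖ ≤ v i t ξ →
      DiniAlong (F i) (v i) t ξ μ ≤ -(p i t * φb i (v i t ξ)))
    (hjump : ∀ ι i j t ξ μ, 0 ≤ t → χ ‖μ‖ ≤ v ι t ξ →
      v i t (ξ + G j t ξ μ) ≤ αb (v ι t ξ))
    (hjump' : ∀ ι i j t ξ μ, 0 ≤ t → v ι t ξ ≤ χ ‖μ‖ → v i t (ξ + G j t ξ μ) ≤ π ‖μ‖)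
    (hq : ContinuousOn q (Ioi 0)) (hqφ : ∀ i y, 0 < y → (φb i y)⁻¹ ≤ q y) (hκ : 0 < κ)
    (hflowC : ∀ i a b, 0 ≤ a → a ≤ b → κ * (b - a) - C ≤ ∫ s in a..b, p i s)
    (hstepC : ∀ i a b l, 0 ≤ a → θ i ≤ b - a → 0 < l →
      κ * (b - a) ≤ (∫ s in a..b, p i s) - ∫ y in l..(αb l), (φb i y)⁻¹)
    (hdwell : ∀ a ∈ σ.γ, ∀ τ ∈ σ.γ, a < τ → θ (σ.σ1 a) ≤ τ - a)
    (ht₀ : 0 ≤ t₀) (hu : IsInput u) (hsol : IsSolution σ.γ (swF F σ) (swG G σ) t₀ x₀ u T x)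
    {t : ℝ} (ht : t₀ ≤ t) (htT : (t : EReal) < T) :
    DecaysTo q αb κ C (v (σ.σ1 t₀) t₀ (x t₀)) (t - t₀) (v (σ.σ1 t) t (x t)) ∨
      ∃ z₀, (z₀ ≤ χ (inputNorm σ.γ u (Ioc t₀ t)) ∨ z₀ ≤ π (inputNorm σ.γ u (Ioc t₀ t)) ∨
          ∃ L, 0 ≤ L ∧ L ≤ χ (inputNorm σ.γ u (Ioc t₀ t)) ∧ z₀ ≤ αb L) ∧
        (v (σ.σ1 t) t (x t) = z₀ ∨ ∃ T', DecaysTo q αb κ C z₀ T' (v (σ.σ1 t) t (x t))) := by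
  set z : ℝ → ℝ := fun s => v (σ.σ1 s) s (x s) with hzdef
  set U := inputNorm σ.γ u (Ioc t₀ t) with hU
  have hU0 : 0 ≤ U := inputNorm_nonneg
  have hc : 0 ≤ χ U := hχ.nonneg hU0
  have hlt : ∀ s ≤ t, (s : EReal) < T := fun s hs => (EReal.coe_le_coe_iff.2 hs).trans_lt htT
  obtain ⟨s, hs, hcase, hz, hzl⟩ := exists_last_le_or (z := z) σ.impulse (χ U)
    (fun τ hτ hτγ => hsol.tendsto_left ht₀ hv hτγ hτ.1 (hlt τ hτ.2)) ht
  have hdec : (s < t ∨ 0 < z s) → DecaysTo q αb κ C (z s) (t - s) (z t) := by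
    refine hsol.decaysTo_of_undisturbed hv hp hpnn hφc hφp hαp hflow hjump hq hqφ hκ hflowC
      hstepC hdwell ht₀ hs.1 hs.2 htT hc ?_ ?_ hz hzl
    · filter_upwards [hu.ae_norm_le_inputNorm (γ := σ.γ) (t := t) ht₀] with r hr hrI
      exact hχ.mono (norm_nonneg _) (hr ⟨hs.1.trans_lt hrI.1, hrI.2⟩)
    · intro r hr
      exact hχ.mono (norm_nonneg _)
        (norm_le_inputNorm_of_mem σ.impulse ⟨hr.1, hs.1.trans_lt hr.2.1, hr.2.2⟩)
  have hend : z t = z s ∨ ∃ T', DecaysTo q αb κ C (z s) T' (z t) := by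
    rcases hs.2.eq_or_lt with h | h
    · exact Or.inl (by rw [h])
    · exact Or.inr ⟨_, hdec (Or.inl h)⟩
  rcases hcase with ⟨rfl, h⟩ | h | ⟨hsγ, h⟩
  · exact Or.inl (hdec (Or.inr (hc.trans_lt h)))
  · exact Or.inr ⟨z s, Or.inl h, hend⟩
  · refine Or.inr ⟨z s, Or.inr ?_, hend⟩
    have hs0 : 0 ≤ s := ht₀.trans hs.1
    obtain ⟨ξ, hl, hx⟩ := hsol.exists_leftLimit ht₀ hv hsγ.1 hsγ.2.1 (hlt s hs.2)
    rcases le_total (χ ‖u s‖) (v (σ.σ1m s) s ξ) with h1 | h1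
    · refine Or.inr ⟨_, hvnn _ _ _ hs0, h _ hl, ?_⟩
      simp only [hzdef, hx]
      exact hjump _ _ _ _ _ _ hs0 h1
    · refine Or.inl ?_
      simp only [hzdef, hx]
      exact (hjump' _ _ _ _ _ _ hs0 h1).trans
        (hπ.mono (norm_nonneg _) (norm_le_inputNorm_of_mem σ.impulse hsγ))

end DwellTime

section Gains

variable {φ1 φ2 χ π α q : ℝ → ℝ} {κ C : ℝ}

lemma ClassKInf.exists_le_of_apply_le {φ : ℝ → ℝ} (hφ : ClassKInf φ) (B : ℝ) :
    ∃ r, 0 ≤ r ∧ ∀ y, 0 ≤ y → φ y ≤ B → y ≤ r := by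
  obtain ⟨r, hr, hB⟩ := hφ.2.2.2 B
  exact ⟨r, hr, fun y hy h => hφ.le_of_apply_le hy hr (h.trans hB)⟩

lemma ClassKInf.exists_le_near_zero {φ : ℝ → ℝ} (hφ : ClassKInf φ) {ε : ℝ} (hε : 0 < ε) :
    ∃ δ > 0, ∀ r, 0 ≤ r → r ≤ δ → φ r ≤ ε :=
  _root_.exists_le_near_zero hφ.1 hφ.2.2.1 hε

/-- Decaying certificates are dominated by a single class `KL` function. -/
lemma exists_classKL_of_decaysTo (hφ1 : ClassKInf φ1) (hφ2 : ClassKInf φ2) (hα : PosDef α)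
    (hq : ContinuousOn q (Ioi 0)) (hqp : ∀ y, 0 < y → 0 ≤ q y) (hκ : 0 < κ) {θ : ℝ} (hθ : 0 < θ) :
    ∃ β, ClassKL β ∧ ∀ r T T' z₀ zt y, 0 ≤ r → 0 ≤ T → z₀ ≤ φ2 r → T ≤ T' + (T' / θ + 1) →
      DecaysTo q α κ C z₀ T' zt → 0 ≤ y → φ1 y ≤ zt → y ≤ β r T := by
  refine (exists_classKL_bound
    (Q := fun r T y => ∃ T' z₀ zt, z₀ ≤ φ2 r ∧ T ≤ T' + (T' / θ + 1) ∧
      DecaysTo q α κ C z₀ T' zt ∧ 0 ≤ y ∧ φ1 y ≤ zt) ?_ ?_ ?_).imp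
    fun β hβ => ⟨hβ.1, fun r T T' z₀ zt y hr hT h1 h2 h3 h4 h5 =>
      hβ.2 r T y hr hT ⟨T', z₀, zt, h1, h2, h3, h4, h5⟩⟩
  · intro R
    obtain ⟨B, -, hB⟩ := DecaysTo.exists_bound (q := q) (κ := κ) (C := C) hα (φ2 R)
    obtain ⟨r', -, hr'⟩ := hφ1.exists_le_of_apply_le B
    refine ⟨r', ?_⟩
    rintro r T y hr hrR hT ⟨T', z₀, zt, h1, h2, h3, h4, h5⟩
    exact hr' y h4 (h5.trans (hB _ _ _ (h1.trans (hφ2.mono hr hrR)) h3))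
  · intro ε hε
    obtain ⟨δ, hδ, h⟩ := DecaysTo.exists_stable (q := q) (κ := κ) (C := C) hα (hφ1.pos hε)
    obtain ⟨δ', hδ', h'⟩ := hφ2.exists_le_near_zero hδ
    refine ⟨δ', hδ', ?_⟩
    rintro r T y hr hrδ hT ⟨T', z₀, zt, h1, h2, h3, h4, h5⟩
    exact hφ1.le_of_apply_le h4 hε.le (h5.trans (h _ _ _ (h1.trans (h' r hr hrδ)) h3))
  · intro R ε hε
    obtain ⟨T₀, h⟩ := DecaysTo.exists_attractive (q := q) (κ := κ) (C := C) hα hq hqp hκ (φ2 R)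
      (hφ1.pos hε)
    refine ⟨T₀ + (T₀ / θ + 1), ?_⟩
    rintro r T y hr hrR hT hTT ⟨T', z₀, zt, h1, h2, h3, h4, h5⟩
    refine hφ1.le_of_apply_le h4 hε.le
      (h5.trans (h _ _ _ (h1.trans (hφ2.mono hr hrR)) ?_ h3))
    by_contra! hcon
    have := div_lt_div_of_pos_right hcon hθ
    linarith

/-- States reached from an input-bounded level are dominated by a class `K∞` gain. -/
lemma exists_classKInf_of_decaysTo (hφ1 : ClassKInf φ1) (hχ : ClassKInf χ) (hπ : ClassKInf π)
    (hα : PosDef α) :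
    ∃ ρ, ClassKInf ρ ∧ ∀ r z₀ zt y, 0 ≤ r →
      (z₀ ≤ χ r ∨ z₀ ≤ π r ∨ ∃ L, 0 ≤ L ∧ L ≤ χ r ∧ z₀ ≤ α L) →
      (zt = z₀ ∨ ∃ T', DecaysTo q α κ C z₀ T' zt) → 0 ≤ y → φ1 y ≤ zt → y ≤ ρ r := by
  refine (exists_classKInf_bound
    (Q := fun r y => ∃ z₀ zt, (z₀ ≤ χ r ∨ z₀ ≤ π r ∨ ∃ L, 0 ≤ L ∧ L ≤ χ r ∧ z₀ ≤ α L) ∧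
      (zt = z₀ ∨ ∃ T', DecaysTo q α κ C z₀ T' zt) ∧ 0 ≤ y ∧ φ1 y ≤ zt) ?_ ?_).imp
    fun ρ hρ => ⟨hρ.1, fun r z₀ zt y hr h1 h2 h3 h4 => hρ.2 r y hr ⟨z₀, zt, h1, h2, h3, h4⟩⟩
  · intro R
    obtain ⟨A, hA⟩ := exists_le_on_Icc hα.1 (χ R)
    set D := max (χ R) (max (π R) A)
    obtain ⟨B, -, hB⟩ := DecaysTo.exists_bound (q := q) (κ := κ) (C := C) hα D
    obtain ⟨r', -, hr'⟩ := hφ1.exists_le_of_apply_le (max D B)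
    refine ⟨r', ?_⟩
    rintro r y hr hrR ⟨z₀, zt, h1, h2, h3, h4⟩
    refine hr' y h3 (h4.trans ?_)
    have hz : z₀ ≤ D := by
      rcases h1 with h1 | h1 | ⟨L, hL, hLχ, h1⟩
      · exact le_max_of_le_left (h1.trans (hχ.mono hr hrR))
      · exact le_max_of_le_right (le_max_of_le_left (h1.trans (hπ.mono hr hrR)))
      · exact le_max_of_le_right (le_max_of_le_right
          (h1.trans (hA L hL (hLχ.trans (hχ.mono hr hrR)))))
    rcases h2 with rfl | ⟨T', h2⟩
    · exact le_max_of_le_left hz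
    · exact le_max_of_le_right (hB _ _ _ hz h2)
  · intro ε hε
    obtain ⟨δ, hδ, h⟩ := DecaysTo.exists_stable (q := q) (κ := κ) (C := C) hα (hφ1.pos hε)
    set η := min δ (φ1 ε)
    have hη : 0 < η := lt_min hδ (hφ1.pos hε)
    obtain ⟨δ₁, hδ₁, hα'⟩ := _root_.exists_le_near_zero hα.1 hα.2.1 hη
    obtain ⟨δ₂, hδ₂, hχ'⟩ := hχ.exists_le_near_zero (lt_min hδ₁ hη)
    obtain ⟨δ₃, hδ₃, hπ'⟩ := hπ.exists_le_near_zero hη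
    refine ⟨min δ₂ δ₃, lt_min hδ₂ hδ₃, ?_⟩
    rintro r y hr hrδ ⟨z₀, zt, h1, h2, h3, h4⟩
    have hχr := hχ' r hr (hrδ.trans (min_le_left _ _))
    have hz : z₀ ≤ η := by
      rcases h1 with h1 | h1 | ⟨L, hL, hLχ, h1⟩
      · exact h1.trans (hχr.trans (min_le_right _ _))
      · exact h1.trans (hπ' r hr (hrδ.trans (min_le_right _ _)))
      · exact h1.trans (hα' L hL (hLχ.trans (hχr.trans (min_le_left _ _))))
    refine hφ1.le_of_apply_le h3 hε.le (h4.trans ?_)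
    rcases h2 with rfl | ⟨T', h2⟩
    · exact hz.trans (min_le_right _ _)
    · exact h _ _ _ (hz.trans (min_le_left _ _)) h2

end Gains

/-- The dwell-time condition yields a uniform decay rate for one mode. -/
lemma exists_rate {p φ α : ℝ → ℝ} {θ M : ℝ} (hp : LocIntegrable p)
    (hpnn : ∀ t, 0 ≤ t → 0 ≤ p t) (hθ : 0 < θ)
    (hM : M = sInf ((fun t => ∫ s in t..(t + θ), p s) '' Ici 0)) (hMpos : 0 < M)
    (hbdd : BddAbove ((fun a => ∫ s in a..(α a), (φ s)⁻¹) '' Ioi 0))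
    (hlt : sSup ((fun a => ∫ s in a..(α a), (φ s)⁻¹) '' Ioi 0) < M) :
    ∃ κ₀ > 0, ∀ κ ≤ κ₀, (∀ a b, 0 ≤ a → a ≤ b → κ * (b - a) - M ≤ ∫ s in a..b, p s) ∧
      ∀ a b l, 0 ≤ a → θ ≤ b - a → 0 < l →
        κ * (b - a) ≤ (∫ s in a..b, p s) - ∫ y in l..(α l), (φ y)⁻¹ := by
  have hm : ∀ t, 0 ≤ t → M ≤ ∫ s in t..(t + θ), p s := by
    intro t ht
    rw [hM]
    refine csInf_le ⟨0, ?_⟩ (mem_image_of_mem _ ht)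
    rintro _ ⟨r, hr, rfl⟩
    exact intervalIntegral.integral_nonneg (by linarith) fun s hs => hpnn s (le_trans hr hs.1)
  set S := sSup ((fun a => ∫ s in a..(α a), (φ s)⁻¹) '' Ioi 0) with hS
  set ε := min (M - S) M with hε
  have hεpos : 0 < ε := lt_min (sub_pos.2 hlt) hMpos
  have hεM : ε ≤ M := min_le_right _ _
  have hεS : ε ≤ M - S := min_le_left _ _
  refine ⟨ε / (2 * θ), by positivity, fun κ hκ => ⟨fun a b ha hab => ?_, fun a b l ha hab hl => ?_⟩⟩
  · have h1 := floor_mul_le_integral hp hpnn hθ hm ha hab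
    have h2 := Nat.lt_floor_add_one ((b - a) / θ)
    have h3 : κ * (b - a) ≤ ε / (2 * θ) * (b - a) :=
      mul_le_mul_of_nonneg_right hκ (sub_nonneg.2 hab)
    have h4 : ε / (2 * θ) * (b - a) = ε / 2 * ((b - a) / θ) := by field_simp
    have h5 : 0 ≤ (b - a) / θ := div_nonneg (sub_nonneg.2 hab) hθ.le
    nlinarith
  · have hab' : a ≤ b := by linarith
    have h1 := floor_mul_le_integral hp hpnn hθ hm ha hab'
    have h2 := Nat.lt_floor_add_one ((b - a) / θ)
    have h3 : κ * (b - a) ≤ ε / (2 * θ) * (b - a) :=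
      mul_le_mul_of_nonneg_right hκ (sub_nonneg.2 hab')
    have h4 : ε / (2 * θ) * (b - a) = ε / 2 * ((b - a) / θ) := by field_simp
    have h5 : (1 : ℝ) ≤ ⌊(b - a) / θ⌋₊ := by
      exact_mod_cast Nat.le_floor (by rw [Nat.cast_one, one_le_div hθ]; exact hab)
    have h6 : ∫ y in l..(α l), (φ y)⁻¹ ≤ S :=
      le_csSup hbdd (mem_image_of_mem (fun a => ∫ s in a..(α a), (φ s)⁻¹) (show l ∈ Ioi 0 from hl))
    have h7 : ε / 2 * ((b - a) / θ) ≤ ε * ⌊(b - a) / θ⌋₊ := by nlinarith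
    have h8 : ε * ((⌊(b - a) / θ⌋₊ : ℝ) - 1) ≤ M * ((⌊(b - a) / θ⌋₊ : ℝ) - 1) :=
      mul_le_mul_of_nonneg_right hεM (by linarith)
    linarith

end Auxiliary

/-- Theorem 6(a): strong `(h⁰,h)`-ISS of the switched impulsive family under
per-mode minimum dwell times. -/
theorem stmt12 {n m : ℕ} {Ic Id : Type*} [Finite Ic]
    (F : Ic → ℝ → Stt n → Stt m → Stt n) (G : Id → ℝ → Stt n → Stt m → Stt n)
    (h0 h : ℝ → Stt n → ℝ)
    (hh0 : ∀ (t : ℝ) (ξ : Stt n), 0 ≤ t → 0 ≤ h0 t ξ)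
    (hh : ∀ (t : ℝ) (ξ : Stt n), 0 ≤ t → 0 ≤ h t ξ)
    (SW : Set (SwSignal Ic Id))
    (v : Ic → ℝ → Stt n → ℝ) (φ1 φ2 χ π : ℝ → ℝ)
    (p : Ic → ℝ → ℝ) (φb : Ic → ℝ → ℝ) (αb : ℝ → ℝ)
    (hp : ∀ i : Ic, LocIntegrable (p i)) (hpnn : ∀ (i : Ic) (t : ℝ), 0 ≤ t → 0 ≤ p i t)
    (hφbc : ∀ i : Ic, ContinuousOn (φb i) (Set.Ici 0)) (hαb : PosDef αb)
    (hA2 : Assumption2 F G h0 h Set.univ v φ1 φ2 χ π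
      (fun i t r => p i t * φb i r) (fun _ _ r => αb r))
    (hpd : ∀ i : Ic, PosDef (φb i))
    (θ : Ic → ℝ) (hθ : ∀ i : Ic, 0 < θ i)
    (hDT : ∀ σ ∈ SW, ∀ (i : Ic) (s : ℝ), (s = 0 ∨ s ∈ σ.γ) → σ.σ1 s = i →
      ∀ t ∈ σ.γ, s < t → θ i ≤ t - s)
    (M : Ic → ℝ)
    (hM : ∀ i : Ic, M i = sInf ((fun t => ∫ s in t..(t + θ i), p i s) '' Set.Ici 0))
    (hMpos : ∀ i : Ic, 0 < M i)
    (hbdd : ∀ i : Ic,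
      BddAbove ((fun a => ∫ s in a..(αb a), (φb i s)⁻¹) '' Set.Ioi 0))
    (hlt : ∀ i : Ic,
      sSup ((fun a => ∫ s in a..(αb a), (φb i s)⁻¹) '' Set.Ioi 0) < M i) :
    SwStronglyISS F G SW h0 h := by
  obtain ⟨hφ1, hφ2, hχ, hπ, hv, -, -, hsand, hflow, hjump, hjump'⟩ := hA2
  have hφp : ∀ i y, 0 < y → 0 < φb i y := fun i => (hpd i).2.2
  have hφc : ∀ i, ContinuousOn (φb i) (Ioi 0) := fun i => (hφbc i).mono Ioi_subset_Ici_self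
  have hvnn : ∀ i t ξ, 0 ≤ t → 0 ≤ v i t ξ := fun i t ξ ht =>
    (hφ1.nonneg (hh t ξ ht)).trans (hsand i t ξ ht).1
  have hrate := fun i => exists_rate (hp i) (hpnn i) (hθ i) (hM i) (hMpos i) (hbdd i) (hlt i)
  choose κ₀ hκ₀ hrate using hrate
  obtain ⟨κ, hκ, hκle⟩ := exists_pos_le_of_finite κ₀ hκ₀
  obtain ⟨θm, hθm, hθle⟩ := exists_pos_le_of_finite θ hθ
  obtain ⟨C, hC⟩ := (finite_range M).bddAbove
  have := Fintype.ofFinite Ic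
  set q : ℝ → ℝ := fun y => ∑ i, (φb i y)⁻¹ with hqdef
  have hq : ContinuousOn q (Ioi 0) := continuousOn_finsetSum _ fun i _ =>
    (hφc i).inv₀ fun y hy => (hφp i y hy).ne'
  have hφinv : ∀ i y, 0 < y → 0 ≤ (φb i y)⁻¹ := fun i y hy => (inv_pos.2 (hφp i y hy)).le
  have hqp : ∀ y, 0 < y → 0 ≤ q y := fun y hy => Finset.sum_nonneg fun i _ => hφinv i y hy
  have hqφ : ∀ i y, 0 < y → (φb i y)⁻¹ ≤ q y := fun i y hy =>
    Finset.single_le_sum (f := fun i => (φb i y)⁻¹) (fun j _ => hφinv j y hy) (Finset.mem_univ i)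
  obtain ⟨β, hβ, hβle⟩ := exists_classKL_of_decaysTo (C := C) hφ1 hφ2 hαb hq hqp hκ hθm
  obtain ⟨ρ, hρ, hρle⟩ := exists_classKInf_of_decaysTo (q := q) (κ := κ) (C := C) hφ1 hχ hπ hαb
  refine ⟨β, ρ, hβ, hρ, fun σ hσ t₀ x₀ u T x ht₀ hu ⟨hsol, _⟩ t ht htT => ?_⟩
  have hdwell : ∀ a ∈ σ.γ, ∀ τ ∈ σ.γ, a < τ → θ (σ.σ1 a) ≤ τ - a := fun a ha τ hτ haτ =>
    hDT σ hσ _ a (Or.inr ha) rfl τ hτ haτ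
  have ht0 : 0 ≤ t := ht₀.trans ht
  have hU : 0 ≤ inputNorm σ.γ u (Ioc t₀ t) := inputNorm_nonneg
  have hT : 0 ≤ t - t₀ + (nJumps σ.γ t₀ t : ℝ) := add_nonneg (sub_nonneg.2 ht) (Nat.cast_nonneg _)
  have hlow := (hsand (σ.σ1 t) t (x t) ht0).1
  rcases hsol.decaysTo_or_le hχ hπ hv hvnn hp hpnn hφc hφp hαb.2.2 hflow
    (fun ι i j => hjump ι i j (mem_univ _)) (fun ι i j => hjump' ι i j (mem_univ _)) hq hqφ hκ
    (fun i a b ha hab => (sub_le_sub_left (hC (mem_range_self i)) _).trans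
      ((hrate i κ (hκle i)).1 a b ha hab))
    (fun i => (hrate i κ (hκle i)).2) hdwell ht₀ hu ht htT with hd | ⟨z₀, hz₀, hd⟩
  · rw [hsol.init] at hd
    refine (hβle _ _ _ _ _ _ (hh0 t₀ x₀ ht₀) hT (hsand _ _ _ ht₀).2 ?_ hd (hh _ _ ht0)
      hlow).trans (le_add_of_nonneg_right (hρ.nonneg hU))
    gcongr
    exact nJumps_le_of_separated hθm
      (fun a ha τ hτ haτ => (hθle _).trans (hdwell a ha τ hτ haτ)) ht
  · exact (hρle _ _ _ _ hU hz₀ hd (hh _ _ ht0) hlow).trans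
      (le_add_of_nonneg_left ((hβ.1 _ hT).nonneg (hh0 t₀ x₀ ht₀)))

end
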